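/- arXiv:2512.08268 — 2 statements merged into one kernel-verified Lean document; each statement's English description precedes it below -/
import Mathlib

section
/- Direct product theorem for score-weighted complexity: there is a universal constant c > 0 (independent of the score function, f, γ, and n) such that for every score function φ, every (possibly partial) function f : X → {0,1} with X ⊆ {0,1}^m, every score parameter γ ∈ [1/2, 1], and every integer n ≥ 1, sup over probability distributions ν on X of sR̄̄_{γ^n}^{ν^n}(f^n) is at least c·n·sR̄̄_γ(f); in particular the maximum score-weighted distributional complexity satisfies sR̄̄_{γ^n}(f^n) ≥ c·n·sR̄̄_γ(f). -/
open Finset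

/-- Deterministic decision trees querying coordinates `i : ι` of inputs `x : ι → Bool`,
with leaves labelled by elements of `L`. -/
inductive DTree (ι : Type) (L : Type) : Type
  | leaf (lab : L) : DTree ι L
  | node (i : ι) (t0 : DTree ι L) (t1 : DTree ι L) : DTree ι L

namespace DTree

variable {ι L : Type}

/-- Output label at the leaf reached by input `x`. -/
def out : DTree ι L → (ι → Bool) → L
  | .leaf lab, _ => lab
  | .node i t0 t1, x => if x i then out t1 x else out t0 x

/-- Number of queries made on input `x` (depth of the leaf reached by `x`). -/
def cost : DTree ι L → (ι → Bool) → ℕ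
  | .leaf _, _ => 0
  | .node i t0 t1, x => (if x i then cost t1 x else cost t0 x) + 1

/-- Maximum leaf depth of the tree. -/
def depth : DTree ι L → ℕ
  | .leaf _ => 0
  | .node _ t0 t1 => max (depth t0) (depth t1) + 1

/-- The set of inputs reaching the same leaf as input `x`. -/
def leafSet : DTree ι L → (ι → Bool) → Set (ι → Bool)
  | .leaf _, _ => Set.univ
  | .node i t0 t1, x => {y | y i = x i} ∩ (if x i then leafSet t1 x else leafSet t0 x)

/-- Every leaf label of the tree satisfies the predicate `P`. -/
def allLabels : DTree ι L → (L → Prop) → Prop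
  | .leaf lab, P => P lab
  | .node _ t0 t1, P => allLabels t0 P ∧ allLabels t1 P

end DTree

/-- A randomized query algorithm: a finitely supported probability distribution over
deterministic decision trees. -/
structure RandAlg (ι : Type) (L : Type) where
  k : ℕ
  p : Fin k → ℝ
  T : Fin k → DTree ι L
  p_nonneg : ∀ j, 0 ≤ p j
  p_sum : ∑ j, p j = 1

/-- A probability distribution on inputs, supported inside the domain `X`. -/
structure InputDist (ι : Type) [Fintype ι] [DecidableEq ι] (X : Set (ι → Bool)) where
  μ : (ι → Bool) → ℝ
  nonneg : ∀ x, 0 ≤ μ x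
  sum_one : ∑ x, μ x = 1
  supp : ∀ x, x ∉ X → μ x = 0

/-- A score function `φ : [0,1] → [1/2,1]`. -/
structure ScoreFun where
  φ : ℝ → ℝ
  continuous : ContinuousOn φ (Set.Icc 0 1)
  half_le : ∀ p ∈ Set.Icc (0:ℝ) 1, 1 / 2 ≤ φ p
  le_one : ∀ p ∈ Set.Icc (0:ℝ) 1, φ p ≤ 1
  map_zero : φ 0 = 1
  map_one : φ 1 = 1
  map_half : φ (1 / 2) = 1 / 2
  symm : ∀ p ∈ Set.Icc (0:ℝ) 1, φ (1 - p) = φ p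
  mono : MonotoneOn φ (Set.Icc (1 / 2) 1)

section Defs

variable {ι L : Type} [Fintype ι] [DecidableEq ι]

/-- Mass of a set of inputs under the weight function `μ`. -/
noncomputable def mass (μ : (ι → Bool) → ℝ) (S : Set (ι → Bool)) : ℝ :=
  ∑ x, Set.indicator S μ x

/-- Score `φ(μ(ℓ₁)/μ(ℓ))` of the leaf `ℓ` reached by `x` in the tree `t`. -/
noncomputable def leafScore (S : ScoreFun) (f : (ι → Bool) → Bool) (μ : (ι → Bool) → ℝ)
    (t : DTree ι L) (x : ι → Bool) : ℝ :=
  S.φ (mass μ (t.leafSet x ∩ {y | f y = true}) / mass μ (t.leafSet x))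

/-- Score of a randomized algorithm: `E_{D∼R, x∼μ}[score(D(x))]`. -/
noncomputable def algScore (S : ScoreFun) (f : (ι → Bool) → Bool) (μ : (ι → Bool) → ℝ)
    (R : RandAlg ι L) : ℝ :=
  ∑ j, R.p j * ∑ x, μ x * leafScore S f μ (R.T j) x

/-- Expected cost `E_{D∼R, x∼μ}[cost(D(x))]`. -/
noncomputable def expCost (μ : (ι → Bool) → ℝ) (R : RandAlg ι L) : ℝ :=
  ∑ j, R.p j * ∑ x, μ x * ((R.T j).cost x : ℝ)

/-- Score-weighted cost `E[score(D(x))·cost(D(x))] / E[score(D(x))]`. -/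
noncomputable def scost (S : ScoreFun) (f : (ι → Bool) → Bool) (μ : (ι → Bool) → ℝ)
    (R : RandAlg ι L) : ℝ :=
  (∑ j, R.p j * ∑ x, μ x * (leafScore S f μ (R.T j) x * ((R.T j).cost x : ℝ))) /
    algScore S f μ R

/-- Discounted score `E[score(D(x))·e^{-α·cost(D(x))}]`. -/
noncomputable def dScore (S : ScoreFun) (f : (ι → Bool) → Bool) (μ : (ι → Bool) → ℝ)
    (α : ℝ) (R : RandAlg ι L) : ℝ :=
  ∑ j, R.p j * ∑ x, μ x *
    (leafScore S f μ (R.T j) x * Real.exp (-(α * ((R.T j).cost x : ℝ))))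

/-- Maximum discounted score `DS_α^μ(f)`. -/
noncomputable def DS (S : ScoreFun) (f : (ι → Bool) → Bool) (μ : (ι → Bool) → ℝ)
    (α : ℝ) : ℝ :=
  ⨆ R : RandAlg ι Unit, dScore S f μ α R

/-- Distributional score-weighted query complexity `sR̄̄_γ^μ(f)`. -/
noncomputable def sRdist (S : ScoreFun) (f : (ι → Bool) → Bool) (μ : (ι → Bool) → ℝ)
    (γ : ℝ) : ℝ :=
  sInf {c | ∃ R : RandAlg ι Unit, γ ≤ algScore S f μ R ∧ scost S f μ R = c}

/-- Distributional query complexity `R̄̄_γ^μ(f)` (expected cost). -/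
noncomputable def Rdist (S : ScoreFun) (f : (ι → Bool) → Bool) (μ : (ι → Bool) → ℝ)
    (γ : ℝ) : ℝ :=
  sInf {c | ∃ R : RandAlg ι Unit, γ ≤ algScore S f μ R ∧ expCost μ R = c}

/-- Maximum score-weighted distributional query complexity `sR̄̄_γ(f)`. -/
noncomputable def sRmax (S : ScoreFun) (X : Set (ι → Bool)) (f : (ι → Bool) → Bool)
    (γ : ℝ) : ℝ :=
  ⨆ μ : InputDist ι X, sRdist S f μ.μ γ

/-- Maximum distributional query complexity `R̄̄_γ(f)`. -/
noncomputable def Rmax (S : ScoreFun) (X : Set (ι → Bool)) (f : (ι → Bool) → Bool)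
    (γ : ℝ) : ℝ :=
  ⨆ μ : InputDist ι X, Rdist S f μ.μ γ

/-- Success-probability score `max{μ(ℓ₀),μ(ℓ₁)}/μ(ℓ)` of the leaf reached by `x`. -/
noncomputable def succLeafScore (f : (ι → Bool) → Bool) (μ : (ι → Bool) → ℝ)
    (t : DTree ι L) (x : ι → Bool) : ℝ :=
  max (mass μ (t.leafSet x ∩ {y | f y = false})) (mass μ (t.leafSet x ∩ {y | f y = true})) /
    mass μ (t.leafSet x)

/-- Success-probability score of a randomized algorithm. -/
noncomputable def succAlgScore (f : (ι → Bool) → Bool) (μ : (ι → Bool) → ℝ)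
    (R : RandAlg ι L) : ℝ :=
  ∑ j, R.p j * ∑ x, μ x * succLeafScore f μ (R.T j) x

/-- Distributional query complexity with the success-probability score. -/
noncomputable def succRdist (f : (ι → Bool) → Bool) (μ : (ι → Bool) → ℝ) (γ : ℝ) : ℝ :=
  sInf {c | ∃ R : RandAlg ι Unit, γ ≤ succAlgScore f μ R ∧ expCost μ R = c}

/-- Maximum distributional query complexity `R̄̄_γ(f)` with the success-probability score. -/
noncomputable def succRmax (X : Set (ι → Bool)) (f : (ι → Bool) → Bool) (γ : ℝ) : ℝ :=
  ⨆ μ : InputDist ι X, succRdist f μ.μ γ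

/-- The fraction `q = μ(ℓ₁)/μ(ℓ)` at the leaf reached by `x`. -/
noncomputable def leafBias (f : (ι → Bool) → Bool) (μ : (ι → Bool) → ℝ)
    (t : DTree ι L) (x : ι → Bool) : ℝ :=
  mass μ (t.leafSet x ∩ {y | f y = true}) / mass μ (t.leafSet x)

/-- Hellinger loss `E[2·√(q(1-q))]` of a randomized algorithm. -/
noncomputable def helLossAlg (f : (ι → Bool) → Bool) (μ : (ι → Bool) → ℝ)
    (R : RandAlg ι L) : ℝ :=
  ∑ j, R.p j * ∑ x, μ x *
    (2 * Real.sqrt (leafBias f μ (R.T j) x * (1 - leafBias f μ (R.T j) x)))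

/-- Hellinger score `E[1 - √(q(1-q))]` of a randomized algorithm. -/
noncomputable def helScoreAlg (f : (ι → Bool) → Bool) (μ : (ι → Bool) → ℝ)
    (R : RandAlg ι L) : ℝ :=
  ∑ j, R.p j * ∑ x, μ x *
    (1 - Real.sqrt (leafBias f μ (R.T j) x * (1 - leafBias f μ (R.T j) x)))

/-- `R̄̄_{Hel↓,ε}(f)`: maximum distributional complexity at Hellinger loss `ε`. -/
noncomputable def RmaxHelLoss (X : Set (ι → Bool)) (f : (ι → Bool) → Bool) (ε : ℝ) : ℝ :=
  ⨆ μ : InputDist ι X,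
    sInf {c | ∃ R : RandAlg ι Unit, helLossAlg f μ.μ R ≤ ε ∧ expCost μ.μ R = c}

/-- `R̄̄_{Hel,γ}(f)`: maximum distributional complexity at Hellinger score `γ`. -/
noncomputable def RmaxHel (X : Set (ι → Bool)) (f : (ι → Bool) → Bool) (γ : ℝ) : ℝ :=
  ⨆ μ : InputDist ι X,
    sInf {c | ∃ R : RandAlg ι Unit, γ ≤ helScoreAlg f μ.μ R ∧ expCost μ.μ R = c}

/-- Binary entropy function. -/
noncomputable def binEnt (p : ℝ) : ℝ :=
  -(p * Real.logb 2 p) - (1 - p) * Real.logb 2 (1 - p)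

/-- Exponential-entropy score `E[1 - (1/2)·2^{-h(q)}]` of a randomized algorithm. -/
noncomputable def entScoreAlg (f : (ι → Bool) → Bool) (μ : (ι → Bool) → ℝ)
    (R : RandAlg ι L) : ℝ :=
  ∑ j, R.p j * ∑ x, μ x *
    (1 - (1 / 2) * (2:ℝ) ^ (-(binEnt (leafBias f μ (R.T j) x))))

/-- `R̄̄_{Ent,γ}(f)`: maximum distributional complexity at exponential-entropy score `γ`. -/
noncomputable def RmaxEnt (X : Set (ι → Bool)) (f : (ι → Bool) → Bool) (γ : ℝ) : ℝ :=
  ⨆ μ : InputDist ι X,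
    sInf {c | ∃ R : RandAlg ι Unit, γ ≤ entScoreAlg f μ.μ R ∧ expCost μ.μ R = c}

end Defs

section WorstCase

variable {ι L : Type}

open Classical in
/-- Worst-case randomized query complexity for a generic task: minimum, over randomized
algorithms whose leaf labels satisfy `labelOK` and which on every input `x ∈ X` output a
label `z` with `good x z` with probability at least `δ`, of the maximum leaf depth over
the trees in the support. -/
noncomputable def RwcTask (X : Set (ι → Bool)) (good : (ι → Bool) → L → Prop)
    (labelOK : L → Prop) (δ : ℝ) : ℕ :=
  sInf {d : ℕ | ∃ R : RandAlg ι L,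
    (∀ j, R.p j ≠ 0 → (R.T j).allLabels labelOK) ∧
    (∀ x ∈ X, δ ≤ ∑ j, if good x ((R.T j).out x) then R.p j else 0) ∧
    ∀ j, R.p j ≠ 0 → (R.T j).depth ≤ d}

/-- Worst-case randomized query complexity `R_δ(f)` of a (partial) Boolean function. -/
noncomputable def Rwc (X : Set (ι → Bool)) (f : (ι → Bool) → Bool) (δ : ℝ) : ℕ :=
  RwcTask X (fun x b => b = f x) (fun _ : Bool => True) δ

end WorstCase

section Product

variable {m n : ℕ} {L : Type}

/-- The `i`-th block of an input to the `n`-fold direct product. -/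
def block (x : Fin n × Fin m → Bool) (i : Fin n) : Fin m → Bool := fun j => x (i, j)

/-- The product domain `Xⁿ`. -/
def Xpow (n : ℕ) (X : Set (Fin m → Bool)) : Set (Fin n × Fin m → Bool) :=
  {x | ∀ i, block x i ∈ X}

/-- The `n`-fold direct product `fⁿ`. -/
def fpow (f : (Fin m → Bool) → Bool) (x : Fin n × Fin m → Bool) : Fin n → Bool :=
  fun i => f (block x i)

/-- The product distribution `μⁿ`. -/
noncomputable def prodMu (μ : (Fin m → Bool) → ℝ) (x : Fin n × Fin m → Bool) : ℝ :=
  ∏ i, μ (block x i)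

/-- The `i`-th factor `ℓ^(i)` of the (product) leaf reached by `x` in a decision tree for `fⁿ`. -/
def blockSet (t : DTree (Fin n × Fin m) L) (x : Fin n × Fin m → Bool) (i : Fin n) :
    Set (Fin m → Bool) :=
  {y | (fun q : Fin n × Fin m => if q.1 = i then y q.2 else x q) ∈ t.leafSet x}

/-- Score of a leaf of a tree for `fⁿ` under `μⁿ`: the product of the scores of its factors. -/
noncomputable def prodLeafScore (S : ScoreFun) (f : (Fin m → Bool) → Bool)
    (μ : (Fin m → Bool) → ℝ) (t : DTree (Fin n × Fin m) L) (x : Fin n × Fin m → Bool) : ℝ :=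
  ∏ i, S.φ (mass μ (blockSet t x i ∩ {y | f y = true}) / mass μ (blockSet t x i))

/-- Score of a randomized algorithm for `fⁿ` under `μⁿ`. -/
noncomputable def algScoreN (S : ScoreFun) (f : (Fin m → Bool) → Bool)
    (μ : (Fin m → Bool) → ℝ) (R : RandAlg (Fin n × Fin m) L) : ℝ :=
  ∑ j, R.p j * ∑ x, prodMu μ x * prodLeafScore S f μ (R.T j) x

/-- Score-weighted cost of a randomized algorithm for `fⁿ` under `μⁿ`. -/
noncomputable def scostN (S : ScoreFun) (f : (Fin m → Bool) → Bool)
    (μ : (Fin m → Bool) → ℝ) (R : RandAlg (Fin n × Fin m) L) : ℝ :=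
  (∑ j, R.p j * ∑ x, prodMu μ x * (prodLeafScore S f μ (R.T j) x * ((R.T j).cost x : ℝ))) /
    algScoreN S f μ R

/-- Discounted score of a randomized algorithm for `fⁿ` under `μⁿ`. -/
noncomputable def dScoreN (S : ScoreFun) (f : (Fin m → Bool) → Bool)
    (μ : (Fin m → Bool) → ℝ) (α : ℝ) (R : RandAlg (Fin n × Fin m) L) : ℝ :=
  ∑ j, R.p j * ∑ x, prodMu μ x *
    (prodLeafScore S f μ (R.T j) x * Real.exp (-(α * ((R.T j).cost x : ℝ))))

/-- Maximum discounted score `DS_α^{μⁿ}(fⁿ)`. -/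
noncomputable def DSN (S : ScoreFun) (f : (Fin m → Bool) → Bool)
    (μ : (Fin m → Bool) → ℝ) (α : ℝ) (n : ℕ) : ℝ :=
  ⨆ R : RandAlg (Fin n × Fin m) Unit, dScoreN S f μ α R

/-- Distributional score-weighted query complexity `sR̄̄_γ^{μⁿ}(fⁿ)`. -/
noncomputable def sRdistN (S : ScoreFun) (f : (Fin m → Bool) → Bool)
    (μ : (Fin m → Bool) → ℝ) (γ : ℝ) (n : ℕ) : ℝ :=
  sInf {c | ∃ R : RandAlg (Fin n × Fin m) Unit,
    γ ≤ algScoreN S f μ R ∧ scostN S f μ R = c}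

/-- Worst-case randomized query complexity `R_δ(fⁿ)` of computing `fⁿ` exactly. -/
noncomputable def RwcN (X : Set (Fin m → Bool)) (f : (Fin m → Bool) → Bool)
    (n : ℕ) (δ : ℝ) : ℕ :=
  RwcTask (Xpow n X) (fun x z => z = fpow f x) (fun _ : Fin n → Bool => True) δ

/-- Success-probability score `max_z μ(ℓ ∩ (fⁿ)⁻¹(z))/μ(ℓ)` of a leaf of a tree for `fⁿ`
under an arbitrary distribution `μ` on `Xⁿ`. -/
noncomputable def succLeafScoreN (f : (Fin m → Bool) → Bool)
    (μ : (Fin n × Fin m → Bool) → ℝ) (t : DTree (Fin n × Fin m) L)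
    (x : Fin n × Fin m → Bool) : ℝ :=
  (⨆ z : Fin n → Bool, mass μ (t.leafSet x ∩ {y | fpow f y = z})) / mass μ (t.leafSet x)

/-- Success-probability score of a randomized algorithm for `fⁿ`. -/
noncomputable def succAlgScoreN (f : (Fin m → Bool) → Bool)
    (μ : (Fin n × Fin m → Bool) → ℝ) (R : RandAlg (Fin n × Fin m) L) : ℝ :=
  ∑ j, R.p j * ∑ x, μ x * succLeafScoreN f μ (R.T j) x

/-- Score-weighted cost of a randomized algorithm for `fⁿ` (success-probability score). -/
noncomputable def succScostN (f : (Fin m → Bool) → Bool)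
    (μ : (Fin n × Fin m → Bool) → ℝ) (R : RandAlg (Fin n × Fin m) L) : ℝ :=
  (∑ j, R.p j * ∑ x, μ x * (succLeafScoreN f μ (R.T j) x * ((R.T j).cost x : ℝ))) /
    succAlgScoreN f μ R

/-- Maximum score-weighted distributional query complexity `sR̄̄_δ(fⁿ)`
(success-probability score). -/
noncomputable def succSRmaxN (X : Set (Fin m → Bool)) (f : (Fin m → Bool) → Bool)
    (n : ℕ) (δ : ℝ) : ℝ :=
  ⨆ μ : InputDist (Fin n × Fin m) (Xpow n X),
    sInf {c | ∃ R : RandAlg (Fin n × Fin m) Unit,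
      δ ≤ succAlgScoreN f μ.μ R ∧ succScostN f μ.μ R = c}

/-- Worst-case randomized query complexity of the list-decoding task `LD_ℓⁿ ∘ f`. -/
noncomputable def RwcLD (X : Set (Fin m → Bool)) (f : (Fin m → Bool) → Bool)
    (n ℓ : ℕ) (δ : ℝ) : ℕ :=
  RwcTask (Xpow n X) (fun x S => fpow f x ∈ S)
    (fun S : Finset (Fin n → Bool) => S.card = 2 ^ (n - ℓ)) δ

open Classical in
/-- Worst-case randomized query complexity of the threshold task `Thr_kⁿ ∘ f`. -/
noncomputable def RwcThr (X : Set (Fin m → Bool)) (f : (Fin m → Bool) → Bool)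
    (n k : ℕ) (δ : ℝ) : ℕ :=
  RwcTask (Xpow n X)
    (fun x z => k ≤ (Finset.univ.filter fun i => z i = fpow f x i).card)
    (fun _ : Fin n → Bool => True) δ

open Classical in
/-- Worst-case randomized query complexity of the labelled threshold task `Label_kⁿ ∘ f`. -/
noncomputable def RwcLabel (X : Set (Fin m → Bool)) (f : (Fin m → Bool) → Bool)
    (n k : ℕ) (δ : ℝ) : ℕ :=
  RwcTask (Xpow n X)
    (fun x z => ∀ i b, z i = some b → fpow f x i = b)
    (fun z : Fin n → Option Bool =>
      (Finset.univ.filter fun i => (z i).isSome).card = k) δ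

end Product

section Lagrange

/-- A supporting line at `γ` for the lower boundary of the convex hull of the points
`(s t, c t)`, in Lagrangian form. -/
theorem exists_lagrange_multiplier {τ : Type*} (s c : τ → ℝ) {γ v : ℝ} (hγ : 0 < γ)
    (hv : 0 < v) (hc : ∀ t, 0 ≤ c t) (hfin : (Set.range s).Finite)
    (hmix : ∀ t₀ t₁ a, 0 ≤ a → a ≤ 1 → γ ≤ (1 - a) * s t₀ + a * s t₁ →
      v * ((1 - a) * s t₀ + a * s t₁) ≤ (1 - a) * c t₀ + a * c t₁) :
    ∃ α, 0 < α ∧ ∀ t, s t - α * c t ≤ γ * (1 - α * v) := by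
  suffices h : ∃ β, 0 < β ∧ ∀ t, β * (s t - γ) ≤ c t - γ * v by
    obtain ⟨β, hβ, h⟩ := h
    refine ⟨β⁻¹, inv_pos.2 hβ, fun t => ?_⟩
    have := mul_le_mul_of_nonneg_left (h t) (inv_pos.2 hβ).le
    rw [← mul_assoc, inv_mul_cancel₀ hβ.ne', one_mul] at this
    linarith
  have hpure : ∀ t, γ ≤ s t → v * s t ≤ c t := fun t ht => by
    have := hmix t t 0 le_rfl zero_le_one (by linarith)
    linarith
  by_cases hex : ∃ t, γ < s t
  · obtain ⟨t₁, ht₁⟩ := hex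
    let slopes : Set ℝ := {b | ∃ t, γ < s t ∧ (c t - γ * v) / (s t - γ) = b}
    have hne : slopes.Nonempty := ⟨_, t₁, ht₁, rfl⟩
    have hlow : ∀ b ∈ slopes, v ≤ b := by
      rintro b ⟨t, ht, rfl⟩
      rw [le_div_iff₀ (by linarith)]
      linarith [hpure t ht.le]
    refine ⟨sInf slopes, hv.trans_le (le_csInf hne hlow), fun t => ?_⟩
    rcases lt_trichotomy (s t) γ with ht | ht | ht
    · have hle : (γ * v - c t) / (γ - s t) ≤ sInf slopes := by
        refine le_csInf hne ?_
        rintro b ⟨t', ht', rfl⟩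
        have hd : 0 < s t' - s t := by linarith
        have ha : (1 - (γ - s t) / (s t' - s t)) = (s t' - γ) / (s t' - s t) := by
          field_simp; ring
        have hγ' : (1 - (γ - s t) / (s t' - s t)) * s t + (γ - s t) / (s t' - s t) * s t' = γ := by
          field_simp; ring
        have := hmix t t' ((γ - s t) / (s t' - s t)) (div_nonneg (by linarith) hd.le)
          ((div_le_one hd).2 (by linarith)) hγ'.ge
        rw [hγ', ha, div_mul_eq_mul_div, div_mul_eq_mul_div, ← add_div, le_div_iff₀ hd] at this
        rw [div_le_div_iff₀ (by linarith) (by linarith)]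
        linarith
      rw [div_le_iff₀ (by linarith)] at hle
      linarith
    · have := hpure t ht.ge
      rw [ht] at this ⊢
      linarith
    · have hle : sInf slopes ≤ (c t - γ * v) / (s t - γ) :=
        csInf_le ⟨v, hlow⟩ ⟨t, ht, rfl⟩
      rwa [le_div_iff₀ (by linarith)] at hle
  · push Not at hex
    obtain ⟨δ, hδ, hgap⟩ : ∃ δ > 0, ∀ t, s t < γ → δ ≤ γ - s t := by
      have hfin' : (Set.range s ∩ {r | r < γ}).Finite := hfin.inter_of_left _
      rcases (Set.range s ∩ {r | r < γ}).eq_empty_or_nonempty with he | hne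
      · exact ⟨1, one_pos, fun t ht =>
          (Set.eq_empty_iff_forall_notMem.1 he (s t) ⟨⟨t, rfl⟩, ht⟩).elim⟩
      · obtain ⟨r, ⟨-, hr⟩, hmax⟩ := Set.exists_max_image _ id hfin' hne
        refine ⟨γ - r, sub_pos.2 hr, fun t ht => ?_⟩
        have := hmax (s t) ⟨⟨t, rfl⟩, ht⟩
        simp only [id] at this
        linarith
    refine ⟨γ * v / δ, by positivity, fun t => ?_⟩
    rcases (hex t).lt_or_eq with ht | ht
    · have h1 : γ * v / δ * δ ≤ γ * v / δ * (γ - s t) :=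
        mul_le_mul_of_nonneg_left (hgap t ht) (by positivity)
      rw [div_mul_cancel₀ _ hδ.ne'] at h1
      linarith [hc t]
    · have := hpure t ht.ge
      rw [ht] at this ⊢
      linarith

end Lagrange

namespace DTree

variable {ι L : Type}

/-- The tree cut at depth `d`. -/
def truncate : ℕ → DTree ι Unit → DTree ι Unit
  | _, .leaf _ => .leaf ()
  | 0, .node _ _ _ => .leaf ()
  | d + 1, .node i t0 t1 => .node i (truncate d t0) (truncate d t1)

theorem cost_truncate (d : ℕ) (t : DTree ι Unit) (x : ι → Bool) :
    (truncate d t).cost x = min d (t.cost x) := by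
  induction t generalizing d with
  | leaf => cases d <;> simp [truncate, cost]
  | node i t0 t1 h0 h1 =>
    cases d with
    | zero => simp [truncate, cost]
    | succ d => cases h : x i <;> simp [truncate, cost, h, h0, h1]

theorem leafSet_truncate (d : ℕ) (t : DTree ι Unit) (x : ι → Bool) (h : t.cost x ≤ d) :
    (truncate d t).leafSet x = t.leafSet x := by
  induction t generalizing d with
  | leaf => cases d <;> simp [truncate, leafSet]
  | node i t0 t1 h0 h1 =>
    cases d with
    | zero => simp [cost] at h
    | succ d =>
      cases hx : x i <;> simp only [cost, hx, if_true, add_le_add_iff_right, Bool.false_eq_true,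
        if_false] at h <;> simp [truncate, leafSet, hx, h0, h1, h]

/-- The tree querying all the coordinates of a list. -/
def readAll : List ι → DTree ι Unit
  | [] => .leaf ()
  | i :: l => .node i (readAll l) (readAll l)

theorem cost_readAll (l : List ι) (x : ι → Bool) : (readAll l).cost x = l.length := by
  induction l with
  | nil => rfl
  | cons i l ih => simp [readAll, cost, ih]

theorem leafSet_readAll (l : List ι) (x : ι → Bool) :
    (readAll l).leafSet x = {y | ∀ i ∈ l, y i = x i} := by
  induction l with
  | nil => simp [readAll, leafSet]
  | cons i l ih => ext y; simp [readAll, leafSet, ih]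

end DTree

section Mix

variable {ι L : Type}

/-- The randomized algorithm running `t₁` with probability `a` and `t₀` otherwise. -/
noncomputable def RandAlg.mix (t₀ t₁ : DTree ι L) (a : ℝ) (h0 : 0 ≤ a) (h1 : a ≤ 1) :
    RandAlg ι L where
  k := 2
  p := ![1 - a, a]
  T := ![t₀, t₁]
  p_nonneg := by intro j; fin_cases j <;> simp [h0, h1]
  p_sum := by simp

theorem RandAlg.sum_mix (t₀ t₁ : DTree ι L) (a : ℝ) (h0 : 0 ≤ a) (h1 : a ≤ 1)
    (g : DTree ι L → ℝ) :
    ∑ j, (mix t₀ t₁ a h0 h1).p j * g ((mix t₀ t₁ a h0 h1).T j) = (1 - a) * g t₀ + a * g t₁ :=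
  Fin.sum_univ_two _

end Mix

section Score

variable {ι L : Type} [Fintype ι] [DecidableEq ι]

theorem mass_nonneg {μ : (ι → Bool) → ℝ} (hμ : ∀ x, 0 ≤ μ x) (A : Set (ι → Bool)) :
    0 ≤ mass μ A :=
  Finset.sum_nonneg fun x _ => Set.indicator_nonneg (fun x _ => hμ x) x

theorem mass_mono {μ : (ι → Bool) → ℝ} (hμ : ∀ x, 0 ≤ μ x) {A B : Set (ι → Bool)}
    (h : A ⊆ B) : mass μ A ≤ mass μ B :=
  Finset.sum_le_sum fun x _ => Set.indicator_le_indicator_of_subset h (fun x => hμ x) x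

/-- The score `φ(μ(A₁)/μ(A))` of a set of inputs. -/
noncomputable def setScore (S : ScoreFun) (f : (ι → Bool) → Bool) (μ : (ι → Bool) → ℝ)
    (A : Set (ι → Bool)) : ℝ :=
  S.φ (mass μ (A ∩ {y | f y = true}) / mass μ A)

variable (S : ScoreFun) (f : (ι → Bool) → Bool) {μ : (ι → Bool) → ℝ}

theorem mass_div_mass_mem_Icc (hμ : ∀ x, 0 ≤ μ x) (A : Set (ι → Bool)) :
    mass μ (A ∩ {y | f y = true}) / mass μ A ∈ Set.Icc (0 : ℝ) 1 :=
  ⟨div_nonneg (mass_nonneg hμ _) (mass_nonneg hμ _),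
    div_le_one_of_le₀ (mass_mono hμ Set.inter_subset_left) (mass_nonneg hμ _)⟩

theorem half_le_setScore (hμ : ∀ x, 0 ≤ μ x) (A : Set (ι → Bool)) :
    1 / 2 ≤ setScore S f μ A :=
  S.half_le _ (mass_div_mass_mem_Icc f hμ A)

theorem setScore_nonneg (hμ : ∀ x, 0 ≤ μ x) (A : Set (ι → Bool)) : 0 ≤ setScore S f μ A := by
  linarith [half_le_setScore S f hμ A]

theorem setScore_le_one (hμ : ∀ x, 0 ≤ μ x) (A : Set (ι → Bool)) : setScore S f μ A ≤ 1 :=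
  S.le_one _ (mass_div_mass_mem_Icc f hμ A)

theorem setScore_singleton (x : ι → Bool) : setScore S f μ {x} = 1 := by
  unfold setScore
  cases h : f x with
  | false =>
    have : ({x} ∩ {y | f y = true} : Set (ι → Bool)) = ∅ := by
      ext y; simp only [Set.mem_inter_iff, Set.mem_singleton_iff, Set.mem_ofPred_eq,
        Set.mem_empty_iff_false, iff_false]; rintro ⟨rfl, h'⟩; simp [h] at h'
    rw [this, mass]
    simp [S.map_zero]
  | true =>
    have : ({x} ∩ {y | f y = true} : Set (ι → Bool)) = {x} := by
      ext y; simp only [Set.mem_inter_iff, Set.mem_singleton_iff, Set.mem_ofPred_eq,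
        and_iff_left_iff_imp]; rintro rfl; exact h
    rw [this]
    by_cases h0 : mass μ {x} = 0
    · simp [h0, S.map_zero]
    · rw [div_self h0, S.map_one]

/-- The discounted score of a tree is at most the linearly penalised score of a truncation
of it. -/
theorem exists_discounted_le_linear (hμ : ∀ x, 0 ≤ μ x) {α : ℝ} (hα : 0 < α)
    (t : DTree ι Unit) :
    ∃ t' : DTree ι Unit, ∀ x,
      leafScore S f μ t x * Real.exp (-(6 * α * (t.cost x : ℝ))) ≤
        leafScore S f μ t' x * (1 - α * (t'.cost x : ℝ)) := by
  have hexp : ∀ y : ℝ, 0 ≤ y → Real.exp (-y) ≤ 1 / (1 + y) := fun y hy => by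
    rw [Real.exp_neg, ← one_div]
    exact one_div_le_one_div_of_le (by linarith) (by linarith [Real.add_one_le_exp y])
  have h6 : 0 < 6 * α := by positivity
  set d := ⌊3 / (6 * α)⌋₊ with hd
  have hd1 : 6 * α * d ≤ 3 := by
    have := Nat.floor_le (a := 3 / (6 * α)) (by positivity)
    rw [le_div_iff₀ h6] at this
    linarith
  have hd2 : 3 < 6 * α * (d + 1) := by
    have := Nat.lt_floor_add_one (3 / (6 * α))
    rw [div_lt_iff₀ h6] at this
    linarith
  refine ⟨DTree.truncate d t, fun x => ?_⟩
  rw [DTree.cost_truncate]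
  rcases le_or_gt (t.cost x) d with h | h
  · have hs : leafScore S f μ (DTree.truncate d t) x = leafScore S f μ t x := by
      simp only [leafScore, DTree.leafSet_truncate d t x h]
    rw [hs, min_eq_right h]
    refine mul_le_mul_of_nonneg_left ?_ (setScore_nonneg S f hμ _)
    have hcd : (t.cost x : ℝ) ≤ d := by exact_mod_cast h
    have hy0 : 0 ≤ 6 * α * (t.cost x : ℝ) := by positivity
    have hy3 : 6 * α * (t.cost x : ℝ) ≤ 3 :=
      (mul_le_mul_of_nonneg_left hcd h6.le).trans hd1
    refine (hexp _ hy0).trans ?_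
    rw [div_le_iff₀ (by linarith)]
    nlinarith
  · rw [min_eq_left h.le]
    have hcd : (d : ℝ) + 1 ≤ t.cost x := by exact_mod_cast h
    have hy3 : 3 ≤ 6 * α * (t.cost x : ℝ) :=
      hd2.le.trans (mul_le_mul_of_nonneg_left hcd h6.le)
    have h1 : Real.exp (-(6 * α * (t.cost x : ℝ))) ≤ 1 / 4 := by
      refine (hexp _ (by linarith)).trans ?_
      exact one_div_le_one_div_of_le (by norm_num) (by linarith)
    have h2 : leafScore S f μ t x ≤ 1 := setScore_le_one S f hμ _
    have h3 : 1 / 2 ≤ leafScore S f μ (DTree.truncate d t) x := half_le_setScore S f hμ _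
    have h4 : (1 : ℝ) / 2 ≤ 1 - α * d := by linarith
    calc _ ≤ 1 * (1 / 4 : ℝ) := mul_le_mul h2 h1 (Real.exp_pos _).le zero_le_one
      _ = 1 / 2 * (1 / 2) := by norm_num
      _ ≤ _ := mul_le_mul h3 h4 (by norm_num) (by linarith)

theorem leafScore_readAll (x : ι → Bool) :
    leafScore S f μ (DTree.readAll Finset.univ.toList) x = 1 := by
  have : (DTree.readAll (Finset.univ.toList : List ι)).leafSet x = {x} := by
    rw [DTree.leafSet_readAll]; ext y; simp [funext_iff]
  rw [leafScore, this]
  exact setScore_singleton S f x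

theorem finite_range_score :
    (Set.range fun t : DTree ι L => ∑ x, μ x * leafScore S f μ t x).Finite := by
  have : (Set.range fun t : DTree ι L => ∑ x, μ x * leafScore S f μ t x) ⊆
      Set.range fun F : (ι → Bool) → Set (ι → Bool) => ∑ x, μ x * setScore S f μ (F x) := by
    rintro _ ⟨t, rfl⟩
    exact ⟨t.leafSet, rfl⟩
  exact (Set.finite_range _).subset this

theorem scost_nonneg (hμ : ∀ x, 0 ≤ μ x) (R : RandAlg ι L) : 0 ≤ scost S f μ R := by
  refine div_nonneg ?_ ?_ <;>
    refine Finset.sum_nonneg fun j _ => mul_nonneg (R.p_nonneg j) (Finset.sum_nonneg fun x _ =>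
      mul_nonneg (hμ x) ?_)
  · exact mul_nonneg (setScore_nonneg S f hμ _) (Nat.cast_nonneg _)
  · exact setScore_nonneg S f hμ _

/-- Some discount rate for which no tree has a large discounted score. -/
theorem exists_discount_rate (hμ : ∀ x, 0 ≤ μ x) {γ : ℝ} (hγ : 0 < γ)
    (hv : 0 < sRdist S f μ γ) :
    ∃ α, 0 < α ∧ ∀ t : DTree ι Unit,
      ∑ x, μ x * (leafScore S f μ t x * Real.exp (-(6 * α * (t.cost x : ℝ)))) ≤
        γ * Real.exp (-(α * sRdist S f μ γ)) := by
  have hle : ∀ R : RandAlg ι Unit, γ ≤ algScore S f μ R → sRdist S f μ γ ≤ scost S f μ R :=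
    fun R hR => csInf_le ⟨0, by rintro _ ⟨R, -, rfl⟩; exact scost_nonneg S f hμ R⟩ ⟨R, hR, rfl⟩
  obtain ⟨α, hα, h⟩ := exists_lagrange_multiplier
    (fun t : DTree ι Unit => ∑ x, μ x * leafScore S f μ t x)
    (fun t : DTree ι Unit => ∑ x, μ x * (leafScore S f μ t x * (t.cost x : ℝ)))
    hγ hv
    (fun t => Finset.sum_nonneg fun x _ => mul_nonneg (hμ x)
      (mul_nonneg (setScore_nonneg S f hμ _) (Nat.cast_nonneg _)))
    (finite_range_score S f)
    (fun t₀ t₁ a h0 h1 hs => by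
      have hR := hle (RandAlg.mix t₀ t₁ a h0 h1)
      rw [scost, algScore,
        RandAlg.sum_mix t₀ t₁ a h0 h1 fun t => ∑ x, μ x * leafScore S f μ t x,
        RandAlg.sum_mix t₀ t₁ a h0 h1 fun t =>
          ∑ x, μ x * (leafScore S f μ t x * (t.cost x : ℝ))] at hR
      have := hR hs
      rwa [le_div_iff₀ (hγ.trans_le hs)] at this)
  refine ⟨α, hα, fun t => ?_⟩
  obtain ⟨t', ht'⟩ := exists_discounted_le_linear S f hμ hα t
  calc _ ≤ ∑ x, μ x * (leafScore S f μ t' x * (1 - α * (t'.cost x : ℝ))) :=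
        Finset.sum_le_sum fun x _ => mul_le_mul_of_nonneg_left (ht' x) (hμ x)
    _ = ∑ x, μ x * leafScore S f μ t' x -
          α * ∑ x, μ x * (leafScore S f μ t' x * (t'.cost x : ℝ)) := by
        rw [Finset.mul_sum, ← Finset.sum_sub_distrib]
        exact Finset.sum_congr rfl fun x _ => by ring
    _ ≤ γ * (1 - α * sRdist S f μ γ) := h t'
    _ ≤ _ := mul_le_mul_of_nonneg_left
        (by linarith [Real.add_one_le_exp (-(α * sRdist S f μ γ))]) hγ.le

/-- Discounted score of `t` on the restriction of the problem to the inputs in `A`. -/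
noncomputable def restrictedScore (S : ScoreFun) (f : (ι → Bool) → Bool) (μ : (ι → Bool) → ℝ)
    (α : ℝ) (A : Set (ι → Bool)) (t : DTree ι Unit) : ℝ :=
  ∑ x, A.indicator μ x * (setScore S f μ (A ∩ t.leafSet x) * Real.exp (-(α * (t.cost x : ℝ))))

/-- Maximum discounted score on the restriction of the problem to the inputs in `A`. -/
noncomputable def maxRestrictedScore (S : ScoreFun) (f : (ι → Bool) → Bool)
    (μ : (ι → Bool) → ℝ) (α : ℝ) (A : Set (ι → Bool)) : ℝ :=
  ⨆ t : DTree ι Unit, restrictedScore S f μ α A t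

variable {α : ℝ}

theorem bddAbove_restrictedScore (hμ : ∀ x, 0 ≤ μ x) (hα : 0 ≤ α) (A : Set (ι → Bool)) :
    BddAbove (Set.range (restrictedScore S f μ α A)) := by
  refine ⟨mass μ A, ?_⟩
  rintro _ ⟨t, rfl⟩
  refine Finset.sum_le_sum fun x _ => mul_le_of_le_one_right
    (Set.indicator_nonneg (fun x _ => hμ x) x) ?_
  refine mul_le_one₀ (setScore_le_one S f hμ _) (Real.exp_pos _).le (Real.exp_le_one_iff.2 ?_)
  have : 0 ≤ α * (t.cost x : ℝ) := by positivity
  linarith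

theorem restrictedScore_node (A : Set (ι → Bool)) (i : ι) (t0 t1 : DTree ι Unit) :
    restrictedScore S f μ α A (.node i t0 t1) = Real.exp (-α) *
      (restrictedScore S f μ α (A ∩ {y | y i = false}) t0 +
        restrictedScore S f μ α (A ∩ {y | y i = true}) t1) := by
  simp only [restrictedScore]
  rw [← Finset.sum_add_distrib, Finset.mul_sum]
  refine Finset.sum_congr rfl fun x _ => ?_
  have hexp : ∀ c : ℕ, Real.exp (-(α * ((c + 1 : ℕ) : ℝ))) =
      Real.exp (-α) * Real.exp (-(α * (c : ℝ))) := fun c => by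
    rw [← Real.exp_add]; congr 1; push_cast; ring
  by_cases hA : x ∈ A <;> cases hx : x i <;>
    simp [DTree.leafSet, DTree.cost, hA, hx, Set.indicator, hexp, Set.inter_assoc, -neg_add_rev,
      -Nat.cast_add] <;> ring

theorem setScore_le_maxRestrictedScore (hμ : ∀ x, 0 ≤ μ x) (hα : 0 ≤ α)
    (A : Set (ι → Bool)) :
    mass μ A * setScore S f μ A ≤ maxRestrictedScore S f μ α A := by
  refine le_of_eq_of_le ?_ (le_ciSup (bddAbove_restrictedScore S f hμ hα A) (.leaf ()))
  simp [restrictedScore, DTree.leafSet, DTree.cost, mass, Finset.sum_mul]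

theorem maxRestrictedScore_nonneg (hμ : ∀ x, 0 ≤ μ x) (hα : 0 ≤ α) (A : Set (ι → Bool)) :
    0 ≤ maxRestrictedScore S f μ α A :=
  (mul_nonneg (mass_nonneg hμ A) (setScore_nonneg S f hμ A)).trans
    (setScore_le_maxRestrictedScore S f hμ hα A)

theorem maxRestrictedScore_split_le (hμ : ∀ x, 0 ≤ μ x) (hα : 0 ≤ α) (A : Set (ι → Bool))
    (i : ι) :
    Real.exp (-α) * (maxRestrictedScore S f μ α (A ∩ {y | y i = false}) +
      maxRestrictedScore S f μ α (A ∩ {y | y i = true})) ≤ maxRestrictedScore S f μ α A := by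
  have : Nonempty (DTree ι Unit) := ⟨.leaf ()⟩
  have h : ∀ t0 t1, restrictedScore S f μ α (A ∩ {y | y i = false}) t0 +
      restrictedScore S f μ α (A ∩ {y | y i = true}) t1 ≤
        maxRestrictedScore S f μ α A / Real.exp (-α) := fun t0 t1 => by
    rw [le_div_iff₀' (Real.exp_pos _), ← restrictedScore_node]
    exact le_ciSup (bddAbove_restrictedScore S f hμ hα A) (.node i t0 t1)
  rw [← le_div_iff₀' (Real.exp_pos _), ← le_sub_iff_add_le]
  refine ciSup_le fun t0 => ?_
  rw [le_sub_comm]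
  refine ciSup_le fun t1 => ?_
  linarith [h t0 t1]

end Score

section DirectProduct

variable {m n : ℕ} {L : Type} (S : ScoreFun) (f : (Fin m → Bool) → Bool)
  {μ : (Fin m → Bool) → ℝ} {α : ℝ}

theorem sum_prod_block (g : Fin n → (Fin m → Bool) → ℝ) :
    ∑ x : Fin n × Fin m → Bool, ∏ i, g i (block x i) = ∏ i, ∑ y, g i y := by
  rw [Finset.prod_univ_sum, Fintype.piFinset_univ]
  exact Fintype.sum_equiv (Equiv.curry _ _ _) _ _ fun x => rfl

theorem blockSet_node (i₀ : Fin n) (j₀ : Fin m) (t0 t1 : DTree (Fin n × Fin m) L)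
    (x : Fin n × Fin m → Bool) (i : Fin n) :
    blockSet (.node (i₀, j₀) t0 t1) x i =
      {y | i = i₀ → y j₀ = x (i₀, j₀)} ∩ blockSet (if x (i₀, j₀) then t1 else t0) x i := by
  ext y
  simp only [blockSet, DTree.leafSet, Set.mem_ofPred_eq, Set.mem_inter_iff]
  refine and_congr ?_ ?_
  · by_cases h : i = i₀
    · simp [h]
    · simp [h, Ne.symm h]
  · split_ifs <;> rfl

/-- Discounted score of a tree for `fⁿ` on the restriction to the inputs in `∏ i, A i`. -/
noncomputable def restrictedScoreN (S : ScoreFun) (f : (Fin m → Bool) → Bool)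
    (μ : (Fin m → Bool) → ℝ) (α : ℝ) (A : Fin n → Set (Fin m → Bool))
    (t : DTree (Fin n × Fin m) L) : ℝ :=
  ∑ x, (∏ i, (A i).indicator μ (block x i)) *
    ((∏ i, setScore S f μ (A i ∩ blockSet t x i)) * Real.exp (-(α * (t.cost x : ℝ))))

theorem restrictedScoreN_node (A : Fin n → Set (Fin m → Bool)) (i₀ : Fin n) (j₀ : Fin m)
    (t0 t1 : DTree (Fin n × Fin m) L) :
    restrictedScoreN S f μ α A (.node (i₀, j₀) t0 t1) = Real.exp (-α) *
      (restrictedScoreN S f μ α (Function.update A i₀ (A i₀ ∩ {y | y j₀ = false})) t0 +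
        restrictedScoreN S f μ α (Function.update A i₀ (A i₀ ∩ {y | y j₀ = true})) t1) := by
  simp only [restrictedScoreN]
  rw [← Finset.sum_add_distrib, Finset.mul_sum]
  refine Finset.sum_congr rfl fun x _ => ?_
  have hexp : ∀ c : ℕ, Real.exp (-(α * ((c + 1 : ℕ) : ℝ))) =
      Real.exp (-α) * Real.exp (-(α * (c : ℝ))) := fun c => by
    rw [← Real.exp_add]; congr 1; push_cast; ring
  have hzero : ∀ b, x (i₀, j₀) ≠ b →
      ∏ i, (Function.update A i₀ (A i₀ ∩ {y | y j₀ = b}) i).indicator μ (block x i) = 0 :=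
    fun b hb => Finset.prod_eq_zero (Finset.mem_univ i₀) (by
      rw [Function.update_self]
      exact Set.indicator_of_notMem (fun h => hb h.2) _)
  have hind : ∀ b, x (i₀, j₀) = b →
      ∏ i, (Function.update A i₀ (A i₀ ∩ {y | y j₀ = b}) i).indicator μ (block x i) =
        ∏ i, (A i).indicator μ (block x i) := fun b hb => by
    refine Finset.prod_congr rfl fun i _ => ?_
    by_cases h : i = i₀
    · subst h
      rw [Function.update_self]
      have : block x i j₀ = b := hb
      by_cases hA : block x i ∈ A i <;> simp [Set.indicator, hA, this]
    · rw [Function.update_of_ne h]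
  have hset : ∀ b, x (i₀, j₀) = b → ∀ t : DTree (Fin n × Fin m) L, ∀ i,
      A i ∩ ({y | i = i₀ → y j₀ = b} ∩ blockSet t x i) =
        Function.update A i₀ (A i₀ ∩ {y | y j₀ = b}) i ∩ blockSet t x i := fun b hb t i => by
    by_cases h : i = i₀
    · subst h; simp [Set.inter_assoc]
    · simp [h]
  cases hx : x (i₀, j₀)
  · rw [hzero true (by simp [hx]), hind false hx]
    simp only [blockSet_node, hx, hset false hx, DTree.cost, Bool.false_eq_true, if_false, hexp]
    ring
  · rw [hzero false (by simp [hx]), hind true hx]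
    simp only [blockSet_node, hx, hset true hx, DTree.cost, if_true, hexp]
    ring

/-- Discounted scores of direct products are at most the product of the maximum discounted
scores. -/
theorem restrictedScoreN_le_prod (hμ : ∀ x, 0 ≤ μ x) (hα : 0 ≤ α)
    (t : DTree (Fin n × Fin m) L) (A : Fin n → Set (Fin m → Bool)) :
    restrictedScoreN S f μ α A t ≤ ∏ i, maxRestrictedScore S f μ α (A i) := by
  induction t generalizing A with
  | leaf lab =>
    have : restrictedScoreN S f μ α A (.leaf lab : DTree (Fin n × Fin m) L) =
        ∏ i, mass μ (A i) * setScore S f μ (A i) := by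
      simp only [restrictedScoreN, blockSet, DTree.leafSet, DTree.cost, Set.mem_univ,
        Set.ofPred_true, Set.inter_univ, Nat.cast_zero, mul_zero, neg_zero, Real.exp_zero, mul_one]
      rw [← Finset.sum_mul, sum_prod_block, Finset.prod_mul_distrib]
      rfl
    rw [this]
    exact Finset.prod_le_prod
      (fun i _ => mul_nonneg (mass_nonneg hμ _) (setScore_nonneg S f hμ _))
      fun i _ => setScore_le_maxRestrictedScore S f hμ hα _
  | node q t0 t1 h0 h1 =>
    obtain ⟨i₀, j₀⟩ := q
    rw [restrictedScoreN_node]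
    have hsplit : ∀ B, ∏ i, maxRestrictedScore S f μ α (Function.update A i₀ B i) =
        maxRestrictedScore S f μ α B *
          ∏ i ∈ Finset.univ.erase i₀, maxRestrictedScore S f μ α (A i) := fun B => by
      rw [← Finset.mul_prod_erase _ _ (Finset.mem_univ i₀), Function.update_self]
      congr 1
      exact Finset.prod_congr rfl fun i hi => by
        rw [Function.update_of_ne (Finset.ne_of_mem_erase hi)]
    have hP : 0 ≤ ∏ i ∈ Finset.univ.erase i₀, maxRestrictedScore S f μ α (A i) :=
      Finset.prod_nonneg fun i _ => maxRestrictedScore_nonneg S f hμ hα _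
    calc _ ≤ Real.exp (-α) * (_ + _) :=
          mul_le_mul_of_nonneg_left (add_le_add (h0 _) (h1 _)) (Real.exp_pos _).le
      _ = Real.exp (-α) * (maxRestrictedScore S f μ α (A i₀ ∩ {y | y j₀ = false}) +
            maxRestrictedScore S f μ α (A i₀ ∩ {y | y j₀ = true})) *
            ∏ i ∈ Finset.univ.erase i₀, maxRestrictedScore S f μ α (A i) := by
          rw [hsplit, hsplit]; ring
      _ ≤ maxRestrictedScore S f μ α (A i₀) *
            ∏ i ∈ Finset.univ.erase i₀, maxRestrictedScore S f μ α (A i) :=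
          mul_le_mul_of_nonneg_right (maxRestrictedScore_split_le S f hμ hα _ _) hP
      _ = _ := Finset.mul_prod_erase _ (fun i => maxRestrictedScore S f μ α (A i))
          (Finset.mem_univ i₀)

theorem dScoreN_le_pow (hμ : ∀ x, 0 ≤ μ x) (hα : 0 ≤ α) {M : ℝ}
    (hM : ∀ t : DTree (Fin m) Unit,
      ∑ x, μ x * (leafScore S f μ t x * Real.exp (-(α * (t.cost x : ℝ)))) ≤ M)
    (R : RandAlg (Fin n × Fin m) L) : dScoreN S f μ α R ≤ M ^ n := by
  have : Nonempty (DTree (Fin m) Unit) := ⟨.leaf ()⟩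
  have hmax : maxRestrictedScore S f μ α Set.univ ≤ M := ciSup_le fun t => by
    simp only [restrictedScore, Set.indicator_univ, Set.univ_inter]
    exact hM t
  have htree : ∀ t : DTree (Fin n × Fin m) L, ∑ x, prodMu μ x *
      (prodLeafScore S f μ t x * Real.exp (-(α * (t.cost x : ℝ)))) ≤ M ^ n := fun t => by
    have := restrictedScoreN_le_prod S f hμ hα t fun _ => Set.univ
    simp only [restrictedScoreN, Set.indicator_univ, Set.univ_inter, Finset.prod_const,
      Finset.card_univ, Fintype.card_fin] at this
    exact this.trans (pow_le_pow_left₀ (maxRestrictedScore_nonneg S f hμ hα _) hmax n)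
  calc _ ≤ ∑ j, R.p j * M ^ n :=
        Finset.sum_le_sum fun j _ => mul_le_mul_of_nonneg_left (htree _) (R.p_nonneg j)
    _ = M ^ n := by rw [← Finset.sum_mul, R.p_sum, one_mul]

theorem prodMu_nonneg (hμ : ∀ x, 0 ≤ μ x) (x : Fin n × Fin m → Bool) : 0 ≤ prodMu μ x :=
  Finset.prod_nonneg fun _ _ => hμ _

theorem prodLeafScore_nonneg (hμ : ∀ x, 0 ≤ μ x) (t : DTree (Fin n × Fin m) L)
    (x : Fin n × Fin m → Bool) : 0 ≤ prodLeafScore S f μ t x :=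
  Finset.prod_nonneg fun _ _ => setScore_nonneg S f hμ _

theorem scostN_nonneg (hμ : ∀ x, 0 ≤ μ x) (R : RandAlg (Fin n × Fin m) L) :
    0 ≤ scostN S f μ R := by
  refine div_nonneg ?_ ?_ <;>
    refine Finset.sum_nonneg fun j _ => mul_nonneg (R.p_nonneg j) (Finset.sum_nonneg fun x _ =>
      mul_nonneg (prodMu_nonneg hμ x) ?_)
  · exact mul_nonneg (prodLeafScore_nonneg S f hμ _ _) (Nat.cast_nonneg _)
  · exact prodLeafScore_nonneg S f hμ _ _

/-- Jensen's inequality for the exponential discount under the score-weighted distribution. -/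
theorem algScoreN_mul_exp_le_dScoreN (hμ : ∀ x, 0 ≤ μ x) (R : RandAlg (Fin n × Fin m) L)
    (hR : 0 < algScoreN S f μ R) (α : ℝ) :
    algScoreN S f μ R * Real.exp (-(α * scostN S f μ R)) ≤ dScoreN S f μ α R := by
  set C := scostN S f μ R with hC
  have hsum : ∑ j, R.p j * ∑ x, prodMu μ x *
      (prodLeafScore S f μ (R.T j) x * ((R.T j).cost x : ℝ)) = C * algScoreN S f μ R := by
    rw [hC, scostN, div_mul_cancel₀ _ hR.ne']
  have hlin : ∑ j, R.p j * ∑ x, prodMu μ x * (prodLeafScore S f μ (R.T j) x *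
      (Real.exp (-(α * C)) * (1 - α * (((R.T j).cost x : ℝ) - C)))) =
        algScoreN S f μ R * Real.exp (-(α * C)) := by
    have : ∑ j, R.p j * ∑ x, prodMu μ x * (prodLeafScore S f μ (R.T j) x *
        (Real.exp (-(α * C)) * (1 - α * (((R.T j).cost x : ℝ) - C)))) =
          Real.exp (-(α * C)) * ((1 + α * C) * algScoreN S f μ R - α * ∑ j, R.p j *
            ∑ x, prodMu μ x * (prodLeafScore S f μ (R.T j) x * ((R.T j).cost x : ℝ))) := by
      simp only [algScoreN, Finset.mul_sum, ← Finset.sum_sub_distrib]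
      exact Finset.sum_congr rfl fun j _ => Finset.sum_congr rfl fun x _ => by ring
    rw [this, hsum]
    ring
  rw [← hlin]
  refine Finset.sum_le_sum fun j _ => mul_le_mul_of_nonneg_left (Finset.sum_le_sum fun x _ =>
    mul_le_mul_of_nonneg_left (mul_le_mul_of_nonneg_left ?_ (prodLeafScore_nonneg S f hμ _ _))
      (prodMu_nonneg hμ x)) (R.p_nonneg j)
  have : Real.exp (-(α * ((R.T j).cost x : ℝ))) =
      Real.exp (-(α * C)) * Real.exp (-(α * (((R.T j).cost x : ℝ) - C))) := by
    rw [← Real.exp_add]; congr 1; ring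
  rw [this]
  refine mul_le_mul_of_nonneg_left ?_ (Real.exp_pos _).le
  linarith [Real.add_one_le_exp (-(α * (((R.T j).cost x : ℝ) - C)))]

theorem exists_algScoreN_eq_one (n : ℕ) (hμ : ∑ x, μ x = 1) :
    ∃ R : RandAlg (Fin n × Fin m) Unit,
      algScoreN S f μ R = 1 ∧ scostN S f μ R = (Fintype.card (Fin n × Fin m) : ℝ) := by
  let t : DTree (Fin n × Fin m) Unit := DTree.readAll Finset.univ.toList
  have hscore : ∀ x, prodLeafScore S f μ t x = 1 := fun x => by
    refine Finset.prod_eq_one fun i _ => ?_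
    have : blockSet t x i = {block x i} := by
      ext y
      simp only [blockSet, t, DTree.leafSet_readAll, Finset.mem_toList, Finset.mem_univ,
        forall_const, Set.mem_ofPred_eq, Set.mem_singleton_iff, Prod.forall, funext_iff, block]
      refine ⟨fun h j => by simpa using h i j, fun h i' j => ?_⟩
      split_ifs with hi
      · rw [h j, hi]
      · rfl
    rw [this]
    exact setScore_singleton S f _
  have hcost : ∀ x, t.cost x = Fintype.card (Fin n × Fin m) := fun x => by
    rw [DTree.cost_readAll, Finset.length_toList, Finset.card_univ]
  have hmass : ∑ x : Fin n × Fin m → Bool, prodMu μ x = 1 := by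
    simp only [prodMu, sum_prod_block fun _ => μ, hμ, Finset.prod_const_one]
  let R := RandAlg.mix t t 0 le_rfl zero_le_one
  have hs : algScoreN S f μ R = 1 := by
    refine (RandAlg.sum_mix t t 0 le_rfl zero_le_one fun t =>
      ∑ x, prodMu μ x * prodLeafScore S f μ t x).trans ?_
    simp [hscore, hmass]
  refine ⟨R, hs, ?_⟩
  rw [scostN, hs, div_one]
  refine (RandAlg.sum_mix t t 0 le_rfl zero_le_one fun t =>
    ∑ x, prodMu μ x * (prodLeafScore S f μ t x * (t.cost x : ℝ))).trans ?_
  simp [hscore, hcost, ← Finset.sum_mul, hmass]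

/-- The direct product theorem for a fixed input distribution. -/
theorem sRdist_le_sRdistN {γ : ℝ} (hμ : ∀ x, 0 ≤ μ x) (hμ1 : ∑ x, μ x = 1) (hγ : 0 < γ)
    (hγ1 : γ ≤ 1) (n : ℕ) :
    1 / 6 * n * sRdist S f μ γ ≤ sRdistN S f μ (γ ^ n) n := by
  refine le_csInf ?_ ?_
  · obtain ⟨R, hR, -⟩ := exists_algScoreN_eq_one S f n hμ1
    exact ⟨_, R, hR ▸ pow_le_one₀ hγ.le hγ1, rfl⟩
  rintro _ ⟨R, hR, rfl⟩
  rcases le_or_gt (sRdist S f μ γ) 0 with hv | hv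
  · exact (mul_nonpos_of_nonneg_of_nonpos (by positivity) hv).trans (scostN_nonneg S f hμ R)
  obtain ⟨α, hα, hM⟩ := exists_discount_rate S f hμ hγ hv
  have hpow : 0 < γ ^ n := pow_pos hγ n
  have h := calc
    γ ^ n * Real.exp (-(6 * α * scostN S f μ R))
      ≤ algScoreN S f μ R * Real.exp (-(6 * α * scostN S f μ R)) :=
        mul_le_mul_of_nonneg_right hR (Real.exp_pos _).le
    _ ≤ dScoreN S f μ (6 * α) R :=
        algScoreN_mul_exp_le_dScoreN S f hμ R (hpow.trans_le hR) _
    _ ≤ (γ * Real.exp (-(α * sRdist S f μ γ))) ^ n :=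
        dScoreN_le_pow S f hμ (by positivity) hM R
    _ = γ ^ n * Real.exp (n * -(α * sRdist S f μ γ)) := by rw [mul_pow, Real.exp_nat_mul]
  have h' := Real.exp_le_exp.1 (le_of_mul_le_mul_left h hpow)
  refine le_of_mul_le_mul_left ?_ hα
  linarith

theorem sRdistN_le_card {γ : ℝ} (hμ : ∀ x, 0 ≤ μ x) (hμ1 : ∑ x, μ x = 1) (hγ1 : γ ≤ 1)
    (n : ℕ) : sRdistN S f μ γ n ≤ Fintype.card (Fin n × Fin m) := by
  obtain ⟨R, hR, hc⟩ := exists_algScoreN_eq_one S f n hμ1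
  exact csInf_le ⟨0, by rintro _ ⟨R, -, rfl⟩; exact scostN_nonneg S f hμ R⟩
    ⟨R, hγ1.trans_eq hR.symm, hc⟩

end DirectProduct

/-- **Direct product theorem for score-weighted complexity**:
`sup_ν sR̄̄_{γⁿ}^{νⁿ}(fⁿ) ≥ c·n·sR̄̄_γ(f)` for a universal constant `c > 0`. -/
theorem direct_product_theorem_sR :
    ∃ c : ℝ, 0 < c ∧
      ∀ (m : ℕ) (S : ScoreFun) (X : Set (Fin m → Bool)) (f : (Fin m → Bool) → Bool)
        (γ : ℝ), 1 / 2 ≤ γ → γ ≤ 1 → ∀ n : ℕ, 1 ≤ n →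
        c * n * (⨆ μ : InputDist (Fin m) X, sRdist S f μ.μ γ) ≤
          ⨆ ν : InputDist (Fin m) X, sRdistN S f ν.μ (γ ^ n) n := by
  refine ⟨1 / 6, by norm_num, fun m S X f γ hγ hγ1 n _ => ?_⟩
  have hγ0 : 0 < γ := by linarith
  rcases isEmpty_or_nonempty (InputDist (Fin m) X) with hX | hX
  · simp [Real.iSup_of_isEmpty]
  rw [Real.mul_iSup_of_nonneg (by positivity)]
  refine ciSup_le fun ν => (sRdist_le_sRdistN S f ν.nonneg ν.sum_one hγ0 hγ1 n).trans ?_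
  refine le_ciSup (f := fun ν : InputDist (Fin m) X => sRdistN S f ν.μ (γ ^ n) n)
    ⟨(Fintype.card (Fin n × Fin m) : ℝ), ?_⟩ ν
  rintro _ ⟨ν', rfl⟩
  exact sRdistN_le_card S f ν'.nonneg ν'.sum_one (pow_le_one₀ hγ0.le hγ1) n
end

section
/- Optimal direct product theorem, upper bound: there are universal constants C and c such that for every (possibly partial) function f : X → {0,1} with X ⊆ {0,1}^m, every success probability γ ∈ (1/2, 1), and every integer n ≥ c / (min{2γ−1, 1−γ})², the worst-case randomized query complexity of the n-fold direct product satisfies R_{γ^n}(f^n) ≤ C·n·R̄̄_γ(f), where R̄̄_γ(f) is the maximum distributional query complexity of f with the success-probability score. -/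
open Finset

namespace DTree

variable {ι κ L L' : Type}

/-- Run `t`, then continue with the tree `k lab` at each leaf labelled `lab`. -/
def bind : DTree ι L → (L → DTree ι L') → DTree ι L'
  | .leaf lab, k => k lab
  | .node i t0 t1, k => .node i (bind t0 k) (bind t1 k)

theorem out_bind (t : DTree ι L) (k : L → DTree ι L') (x : ι → Bool) :
    (t.bind k).out x = (k (t.out x)).out x := by
  induction t with
  | leaf lab => rfl
  | node i t0 t1 h0 h1 =>
    simp only [bind, out]
    split_ifs <;> assumption

theorem cost_bind (t : DTree ι L) (k : L → DTree ι L') (x : ι → Bool) :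
    (t.bind k).cost x = t.cost x + (k (t.out x)).cost x := by
  induction t with
  | leaf lab => simp [bind, cost, out]
  | node i t0 t1 h0 h1 =>
    simp only [bind, out, cost]
    split_ifs <;> omega

/-- The majority vote of three trees run in sequence. -/
def maj3 (t₁ t₂ t₃ : DTree ι Bool) : DTree ι Bool :=
  t₁.bind fun a => t₂.bind fun b => t₃.bind fun c => .leaf (a && b || a && c || b && c)

theorem cost_maj3 (t₁ t₂ t₃ : DTree ι Bool) (x : ι → Bool) :
    (maj3 t₁ t₂ t₃).cost x = t₁.cost x + t₂.cost x + t₃.cost x := by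
  simp [maj3, cost_bind, cost]; ring

/-- The tree querying all coordinates in a list. -/
def queryAll : List ι → DTree ι Unit
  | [] => .leaf ()
  | i :: l => .node i (queryAll l) (queryAll l)

theorem cost_queryAll (l : List ι) (x : ι → Bool) : (queryAll l).cost x = l.length := by
  induction l with
  | nil => rfl
  | cons i l ih => simp [queryAll, cost, ih]

theorem leafSet_queryAll (l : List ι) (x : ι → Bool) :
    (queryAll l).leafSet x = {y | ∀ i ∈ l, y i = x i} := by
  induction l with
  | nil => simp [queryAll, leafSet]
  | cons i l ih =>
    ext y
    simp [queryAll, leafSet, ih]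

end DTree

section Correct

variable {ι : Type}

/-- Indicator that the tree `t` answers `f` correctly on `x`. -/
def DTree.correct (f : (ι → Bool) → Bool) (t : DTree ι Bool) (x : ι → Bool) : ℝ :=
  if t.out x = f x then 1 else 0

theorem DTree.correct_nonneg (f : (ι → Bool) → Bool) (t : DTree ι Bool) (x : ι → Bool) :
    0 ≤ t.correct f x := by
  unfold DTree.correct; split_ifs <;> norm_num

theorem DTree.correct_le_one (f : (ι → Bool) → Bool) (t : DTree ι Bool) (x : ι → Bool) :
    t.correct f x ≤ 1 := by
  unfold DTree.correct; split_ifs <;> norm_num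

theorem DTree.correct_maj3 (f : (ι → Bool) → Bool) (t₁ t₂ t₃ : DTree ι Bool) (x : ι → Bool) :
    (DTree.maj3 t₁ t₂ t₃).correct f x =
      t₁.correct f x * t₂.correct f x + t₁.correct f x * t₃.correct f x +
        t₂.correct f x * t₃.correct f x -
        2 * (t₁.correct f x * t₂.correct f x * t₃.correct f x) := by
  simp only [DTree.correct, DTree.maj3, DTree.out_bind, DTree.out]
  cases t₁.out x <;> cases t₂.out x <;> cases t₃.out x <;> cases f x <;> norm_num

end Correct

section SingleCopy

variable {ι : Type} [Fintype ι] [DecidableEq ι]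

theorem mass_inter_eq (μ : (ι → Bool) → ℝ) (i : ι) (b : Bool) (A : Set (ι → Bool)) :
    mass μ ({y | y i = b} ∩ A) = mass (fun x => if x i = b then μ x else 0) A := by
  classical
  unfold mass
  refine sum_congr rfl fun x _ => ?_
  simp only [Set.indicator_apply, Set.mem_inter_iff, Set.mem_ofPred_eq]
  split_ifs <;> simp_all

theorem succLeafScore_node (f : (ι → Bool) → Bool) (μ : (ι → Bool) → ℝ) {L : Type} (i : ι)
    (t0 t1 : DTree ι L) (x : ι → Bool) :
    succLeafScore f μ (.node i t0 t1) x =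
      if x i then succLeafScore f (fun x => if x i = true then μ x else 0) t1 x
      else succLeafScore f (fun x => if x i = false then μ x else 0) t0 x := by
  unfold succLeafScore
  cases h : x i <;> simp only [DTree.leafSet, h, Set.inter_assoc, mass_inter_eq] <;> simp

/-- Leaves can be labelled so that the success probability reaches the score. -/
theorem exists_relabel (f : (ι → Bool) → Bool) (t : DTree ι Unit) :
    ∀ μ : (ι → Bool) → ℝ, (∀ x, 0 ≤ μ x) →
      ∃ t' : DTree ι Bool, (∀ x, t'.cost x = t.cost x) ∧
        ∑ x, μ x * succLeafScore f μ t x = ∑ x, μ x * t'.correct f x := by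
  induction t with
  | leaf lab =>
    intro μ hμ
    obtain ⟨b, hb⟩ : ∃ b, max (mass μ {y | f y = false}) (mass μ {y | f y = true}) =
        mass μ {y | f y = b} := by
      rcases max_choice (mass μ {y | f y = false}) (mass μ {y | f y = true}) with h | h
      · exact ⟨_, h⟩
      · exact ⟨_, h⟩
    refine ⟨.leaf b, fun x => rfl, ?_⟩
    have h1 : ∑ x, μ x * (DTree.leaf b).correct f x = mass μ {y | f y = b} := by
      unfold mass
      refine sum_congr rfl fun x _ => ?_
      simp [DTree.correct, DTree.out, Set.indicator_apply, eq_comm (a := b)]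
    simp only [succLeafScore, DTree.leafSet, Set.univ_inter]
    rw [h1, hb, ← sum_mul]
    have h2 : mass μ Set.univ = ∑ x, μ x := by simp [mass]
    rw [h2]
    by_cases h0 : ∑ x, μ x = 0
    · have h3 := (sum_eq_zero_iff_of_nonneg fun x _ => hμ x).1 h0
      rw [h0, zero_mul]
      symm
      refine sum_eq_zero fun x hx => ?_
      simp [Set.indicator_apply, h3 x hx]
    · field_simp
  | node i t0 t1 h0 h1 =>
    intro μ hμ
    obtain ⟨s0, hc0, hs0⟩ := h0 (fun x => if x i = false then μ x else 0)
      fun x => by split_ifs <;> simp [hμ]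
    obtain ⟨s1, hc1, hs1⟩ := h1 (fun x => if x i = true then μ x else 0)
      fun x => by split_ifs <;> simp [hμ]
    refine ⟨.node i s0 s1, fun x => by simp [DTree.cost, hc0, hc1], ?_⟩
    trans (∑ x, (if x i = false then μ x else 0) *
        succLeafScore f (fun x => if x i = false then μ x else 0) t0 x) +
      ∑ x, (if x i = true then μ x else 0) *
        succLeafScore f (fun x => if x i = true then μ x else 0) t1 x
    · rw [← sum_add_distrib]
      refine sum_congr rfl fun x _ => ?_
      rw [succLeafScore_node]
      cases h : x i <;> simp
    · rw [hs0, hs1, ← sum_add_distrib]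
      refine sum_congr rfl fun x _ => ?_
      cases h : x i <;> simp [DTree.correct, DTree.out, h]

theorem succLeafScore_queryAll (f : (ι → Bool) → Bool) {μ : (ι → Bool) → ℝ} {x : ι → Bool}
    (hx : μ x ≠ 0) (hμ : 0 ≤ μ x) : succLeafScore f μ (DTree.queryAll univ.toList) x = 1 := by
  have h : (DTree.queryAll (univ : Finset ι).toList).leafSet x = {x} := by
    rw [DTree.leafSet_queryAll]
    ext y
    simp [funext_iff]
  have hm : ∀ b, mass μ ({x} ∩ {y | f y = b}) = if f x = b then μ x else 0 := by
    intro b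
    unfold mass
    rw [sum_eq_single x]
    · simp [Set.indicator_apply]
    · intro y _ hy
      simp [hy]
    · simp
  have h1 : mass μ {x} = μ x := by
    unfold mass
    rw [sum_eq_single x]
    · simp
    · intro y _ hy
      simp [hy]
    · simp
  unfold succLeafScore
  rw [h, hm, hm, h1]
  cases f x <;> simp [hμ, hx]

theorem exists_alg_succAlgScore_eq_one {X : Set (ι → Bool)} (f : (ι → Bool) → Bool)
    (μ : InputDist ι X) :
    ∃ R : RandAlg ι Unit, succAlgScore f μ.μ R = 1 ∧ expCost μ.μ R = Fintype.card ι := by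
  refine ⟨⟨1, fun _ => 1, fun _ => DTree.queryAll univ.toList, by simp, by simp⟩, ?_, ?_⟩
  · simp only [succAlgScore, univ_unique, sum_singleton, one_mul]
    rw [← μ.sum_one]
    refine sum_congr rfl fun x _ => ?_
    by_cases hx : μ.μ x = 0
    · simp [hx]
    · rw [succLeafScore_queryAll f hx (μ.nonneg x), mul_one]
  · simp only [expCost, univ_unique, sum_singleton, one_mul, DTree.cost_queryAll]
    rw [← sum_mul, μ.sum_one]
    simp

theorem expCost_nonneg {X : Set (ι → Bool)} (μ : InputDist ι X) (R : RandAlg ι Unit) :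
    0 ≤ expCost μ.μ R :=
  sum_nonneg fun j _ => mul_nonneg (R.p_nonneg j)
    (sum_nonneg fun x _ => mul_nonneg (μ.nonneg x) (Nat.cast_nonneg _))

/-- The complexity measure is attained up to any slack. -/
theorem exists_alg_of_succRmax_lt {X : Set (ι → Bool)} {f : (ι → Bool) → Bool} {γ c : ℝ}
    (hγ : γ ≤ 1) (hc : succRmax X f γ < c) (μ : InputDist ι X) :
    ∃ R : RandAlg ι Unit, γ ≤ succAlgScore f μ.μ R ∧ expCost μ.μ R < c := by
  have hb : BddAbove (Set.range fun μ : InputDist ι X => succRdist f μ.μ γ) := by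
    refine ⟨Fintype.card ι, ?_⟩
    rintro _ ⟨ν, rfl⟩
    obtain ⟨R, h1, h2⟩ := exists_alg_succAlgScore_eq_one f ν
    refine csInf_le ⟨0, ?_⟩ ⟨R, by rw [h1]; exact hγ, h2⟩
    rintro _ ⟨R, -, rfl⟩
    exact expCost_nonneg ν R
  have h := (le_ciSup hb μ).trans_lt hc
  obtain ⟨R, h1, h2⟩ := exists_alg_succAlgScore_eq_one f μ
  obtain ⟨_, ⟨S, hS, rfl⟩, hlt⟩ := exists_lt_of_csInf_lt (s := {c | ∃ R : RandAlg ι Unit,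
    γ ≤ succAlgScore f μ.μ R ∧ expCost μ.μ R = c}) ⟨_, R, by rw [h1]; exact hγ, rfl⟩ h
  exact ⟨S, hS, hlt⟩

theorem succRmax_nonneg (X : Set (ι → Bool)) (f : (ι → Bool) → Bool) (γ : ℝ) :
    0 ≤ succRmax X f γ := by
  refine Real.iSup_nonneg fun μ => Real.sInf_nonneg ?_
  rintro c ⟨R, -, rfl⟩
  exact expCost_nonneg μ R

/-- Against a fixed input distribution, some tree beats any reward below `γ - κ R̄̄_γ(f)`. -/
theorem exists_tree_of_inputDist {X : Set (ι → Bool)} {f : (ι → Bool) → Bool} {γ κ θ : ℝ}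
    (hγ : γ ≤ 1) (hκ : 0 ≤ κ) (hθ : θ < γ - κ * succRmax X f γ) (μ : InputDist ι X) :
    ∃ t : DTree ι Bool, θ < ∑ x, μ.μ x * (t.correct f x - κ * (t.cost x : ℝ)) := by
  set r := succRmax X f γ
  set δ := (γ - κ * r - θ) / (κ + 1) with hδ
  have hδ0 : 0 < δ := div_pos (by linarith) (by linarith)
  have hκδ : κ * δ < γ - κ * r - θ := by
    have : δ * (κ + 1) = γ - κ * r - θ := by rw [hδ]; field_simp
    nlinarith
  obtain ⟨R, hR, hc⟩ := exists_alg_of_succRmax_lt hγ (show r < r + δ by linarith) μ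
  choose s hcost hs using fun j => exists_relabel f (R.T j) μ.μ μ.nonneg
  have hval : ∑ j, R.p j * ∑ x, μ.μ x * ((s j).correct f x - κ * ((s j).cost x : ℝ)) =
      succAlgScore f μ.μ R - κ * expCost μ.μ R := by
    unfold succAlgScore expCost
    rw [mul_sum, ← sum_sub_distrib]
    refine sum_congr rfl fun j _ => ?_
    rw [hs, mul_left_comm κ, ← mul_sub, mul_sum univ _ κ, ← sum_sub_distrib]
    congr 1
    refine sum_congr rfl fun x _ => ?_
    rw [hcost]; ring
  have hlt : ∑ j, R.p j * θ <
      ∑ j, R.p j * ∑ x, μ.μ x * ((s j).correct f x - κ * ((s j).cost x : ℝ)) := by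
    rw [hval, ← sum_mul, R.p_sum]
    nlinarith
  obtain ⟨j, -, hj⟩ := exists_lt_of_sum_lt hlt
  exact ⟨s j, lt_of_mul_lt_mul_left hj (R.p_nonneg j)⟩

/-- Minimax: one randomized algorithm trades success against cost on every input of `X`. -/
theorem exists_minimax_alg {X : Set (ι → Bool)} {f : (ι → Bool) → Bool} {γ κ θ : ℝ}
    (hγ : γ ≤ 1) (hκ : 0 ≤ κ) (hθ : θ < γ - κ * succRmax X f γ) :
    ∃ (J : Type) (_ : Fintype J) (p : J → ℝ) (T : J → DTree ι Bool),
      (∀ j, 0 ≤ p j) ∧ ∑ j, p j = 1 ∧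
      ∀ y ∈ X, θ + κ * ∑ j, p j * ((T j).cost y : ℝ) ≤ ∑ j, p j * (T j).correct f y := by
  classical
  let vec : DTree ι Bool → X → ℝ := fun t y => t.correct f y - κ * (t.cost y : ℝ)
  let U : Set (X → ℝ) := Set.univ.pi fun _ => Set.Ioi θ
  by_cases hd : Disjoint U (convexHull ℝ (Set.range vec))
  · exfalso
    obtain ⟨ℓ, u, hU, hH⟩ := geometric_hahn_banach_open
      (convex_pi fun _ _ => convex_Ioi θ)
      (isOpen_set_pi Set.finite_univ fun _ _ => isOpen_Ioi) (convex_convexHull ℝ _) hd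
    let w : X → ℝ := fun y => - ℓ (Pi.single y 1)
    have hℓ : ∀ v : X → ℝ, ℓ v = - ∑ y, v y * w y := by
      intro v
      conv_lhs => rw [pi_eq_sum_univ' v]
      simp only [map_sum, map_smul, smul_eq_mul, w, mul_neg, sum_neg_distrib, neg_neg]
    have hU' : ∀ v : X → ℝ, (∀ y, θ < v y) → - ∑ y, v y * w y < u := fun v hv => by
      rw [← hℓ]; exact hU v fun y _ => hv y
    have hH' : ∀ t, ∑ y, vec t y * w y ≤ -u := fun t => by
      have := hH _ (subset_convexHull ℝ _ ⟨t, rfl⟩)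
      rw [hℓ] at this
      linarith
    have hw : ∀ y, 0 ≤ w y := by
      intro y
      by_contra! hneg
      set a : ℝ := ∑ z, (θ + 1) * w z
      obtain ⟨N, hN⟩ : ∃ N : ℝ, 0 ≤ N ∧ u ≤ -(a + N * w y) := by
        refine ⟨(|u| + |a|) / (- w y), div_nonneg (by positivity) (by linarith), ?_⟩
        have : (|u| + |a|) / (- w y) * w y = -(|u| + |a|) := by
          rw [div_neg, neg_mul, div_mul_cancel₀ _ hneg.ne]
        rw [this]
        linarith [le_abs_self u, le_abs_self a]
      have h := hU' (fun z => θ + 1 + if z = y then N else 0) fun z => by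
        split_ifs <;> linarith [hN.1]
      simp only [add_mul, sum_add_distrib, ite_mul, zero_mul, sum_ite_eq', mem_univ,
        if_true] at h
      simp only [a, add_mul, sum_add_distrib] at hN
      linarith [hN.2]
    have hW0 : 0 ≤ ∑ y, w y := sum_nonneg fun y _ => hw y
    have hW : 0 < ∑ y, w y := by
      refine lt_of_le_of_ne hW0 fun h0 => ?_
      have hz := (sum_eq_zero_iff_of_nonneg fun y _ => hw y).1 h0.symm
      have h1 := hU' (fun _ => θ + 1) fun _ => by linarith
      have h2 := hH' (.leaf true)
      rw [sum_eq_zero fun y hy => by rw [hz y hy, mul_zero]] at h1 h2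
      linarith
    have hext : ∀ g : (ι → Bool) → ℝ,
        ∑ x, (if h : x ∈ X then w ⟨x, h⟩ / ∑ y, w y else 0) * g x =
          (∑ y : X, g y * w y) / ∑ y, w y := by
      intro g
      trans ∑ y : X, (if h : (y : ι → Bool) ∈ X then w ⟨y, h⟩ / ∑ y, w y else 0) * g y
      · rw [← sum_subtype (univ.filter (· ∈ X)) (by simp)
          (fun x => (if h : x ∈ X then w ⟨x, h⟩ / ∑ y, w y else 0) * g x), sum_filter]
        refine sum_congr rfl fun x _ => ?_
        split_ifs <;> simp
      · rw [sum_div]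
        refine sum_congr rfl fun y _ => ?_
        simp only [Subtype.coe_prop, dif_pos]
        ring
    let μ : InputDist ι X :=
      { μ := fun x => if h : x ∈ X then w ⟨x, h⟩ / ∑ y, w y else 0
        nonneg := fun x => by split_ifs; exacts [div_nonneg (hw _) hW0, le_rfl]
        sum_one := by
          have h := hext fun _ => 1
          simp only [mul_one, one_mul] at h
          rw [h, div_self hW.ne']
        supp := fun x hx => by simp [hx] }
    obtain ⟨t, ht⟩ := exists_tree_of_inputDist hγ hκ hθ μ
    have hsum : ∑ x, μ.μ x * (t.correct f x - κ * (t.cost x : ℝ)) =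
        (∑ y, vec t y * w y) / ∑ y, w y := hext _
    rw [hsum, lt_div_iff₀ hW] at ht
    have hlt := ht.trans_le (hH' t)
    set gap := -u - θ * ∑ y, w y
    have h := hU' (fun _ => θ + gap / ∑ y, w y) fun y => by
      have : 0 < gap / ∑ y, w y := div_pos (by simp only [gap]; linarith) hW
      linarith
    rw [← mul_sum, add_mul, div_mul_cancel₀ _ hW.ne'] at h
    simp only [gap] at h
    linarith
  · obtain ⟨v, hvU, hvH⟩ := Set.not_disjoint_iff.1 hd
    obtain ⟨J, hJ, p, z, hp, hp1, hz, rfl⟩ := mem_convexHull_iff_exists_fintype.1 hvH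
    choose T hT using hz
    refine ⟨J, hJ, p, T, hp, hp1, fun y hy => ?_⟩
    have h := hvU ⟨y, hy⟩ trivial
    simp only [Set.mem_Ioi, Finset.sum_apply, Pi.smul_apply, smul_eq_mul, ← hT, vec, mul_sub,
      sum_sub_distrib, mul_left_comm _ κ, ← mul_sum] at h
    linarith

end SingleCopy

section Majority

variable {ι : Type}

/-- Taking the majority of three independent runs. -/
theorem exists_majority_alg {J : Type} [Fintype J] (p : J → ℝ) (T : J → DTree ι Bool)
    (f : (ι → Bool) → Bool) (hp : ∀ j, 0 ≤ p j) (hp1 : ∑ j, p j = 1) :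
    ∃ (J' : Type) (_ : Fintype J') (p' : J' → ℝ) (T' : J' → DTree ι Bool),
      (∀ j, 0 ≤ p' j) ∧ ∑ j, p' j = 1 ∧
      ∀ y, ∑ j, p' j * ((T' j).cost y : ℝ) = 3 * ∑ j, p j * ((T j).cost y : ℝ) ∧
        ∑ j, p' j * (T' j).correct f y =
          3 * (∑ j, p j * (T j).correct f y) ^ 2 - 2 * (∑ j, p j * (T j).correct f y) ^ 3 := by
  have key : ∀ a b c : J → ℝ, ∑ q : J × J × J,
      p q.1 * p q.2.1 * p q.2.2 * (a q.1 * b q.2.1 * c q.2.2) =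
      (∑ j, p j * a j) * (∑ j, p j * b j) * ∑ j, p j * c j := by
    intro a b c
    rw [mul_assoc, sum_mul_sum, sum_mul_sum, Fintype.sum_prod_type]
    refine sum_congr rfl fun i _ => ?_
    rw [← mul_sum, Fintype.sum_prod_type, mul_sum]
    refine sum_congr rfl fun j _ => ?_
    simp only [mul_sum]
    exact sum_congr rfl fun k _ => by ring
  have hp1' : ∑ j, p j * 1 = 1 := by simpa using hp1
  refine ⟨J × J × J, inferInstance, fun q => p q.1 * p q.2.1 * p q.2.2,
    fun q => DTree.maj3 (T q.1) (T q.2.1) (T q.2.2),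
    fun q => mul_nonneg (mul_nonneg (hp _) (hp _)) (hp _), ?_, fun y => ⟨?_, ?_⟩⟩
  · have := key 1 1 1
    simpa [hp1] using this
  · set c : J → ℝ := fun j => ((T j).cost y : ℝ) with hc
    have h1 := key c 1 1
    have h2 := key 1 c 1
    have h3 := key 1 1 c
    simp only [Pi.one_apply, mul_one, one_mul, hp1] at h1 h2 h3
    simp only [DTree.cost_maj3, Nat.cast_add, mul_add, sum_add_distrib]
    simp only [hc] at h1 h2 h3
    rw [h1, h2, h3]
    ring
  · set c : J → ℝ := fun j => (T j).correct f y with hc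
    have h1 := key c c 1
    have h2 := key c 1 c
    have h3 := key 1 c c
    have h4 := key c c c
    simp only [Pi.one_apply, mul_one, one_mul, hp1] at h1 h2 h3
    simp only [DTree.correct_maj3, mul_sub, mul_add, sum_add_distrib, sum_sub_distrib,
      mul_left_comm _ (2 : ℝ), ← mul_sum univ _ (2 : ℝ)]
    simp only [hc] at h1 h2 h3 h4
    rw [h1, h2, h3, h4]
    ring

end Majority

section Achieves

variable {κ L : Type}

open Classical in
/-- Some randomized algorithm with all depths at most `d` produces on every input `x` a good
label with probability at least `v x`. -/
def Achieves (good : (κ → Bool) → L → Prop) (d : ℝ) (v : (κ → Bool) → ℝ) : Prop :=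
  ∃ R : RandAlg κ L, (∀ j, ((R.T j).depth : ℝ) ≤ d) ∧
    ∀ x, v x ≤ ∑ j, if good x ((R.T j).out x) then R.p j else 0

variable {good : (κ → Bool) → L → Prop} {d d' : ℝ} {v v' : (κ → Bool) → ℝ}

theorem Achieves.mono (h : Achieves good d v) (hd : d ≤ d') (hv : ∀ x, v' x ≤ v x) :
    Achieves good d' v' := by
  obtain ⟨R, h1, h2⟩ := h
  exact ⟨R, fun j => (h1 j).trans hd, fun x => (hv x).trans (h2 x)⟩

open Classical in
/-- A randomized algorithm may be indexed by any finite type. -/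
theorem Achieves.of_fintype {J : Type} [Fintype J] (p : J → ℝ) (T : J → DTree κ L)
    (hp : ∀ j, 0 ≤ p j) (hp1 : ∑ j, p j = 1) (hd : ∀ j, ((T j).depth : ℝ) ≤ d)
    (hv : ∀ x, v x ≤ ∑ j, if good x ((T j).out x) then p j else 0) : Achieves good d v := by
  let e := (Fintype.equivFin J).symm
  refine ⟨⟨Fintype.card J, p ∘ e, T ∘ e, fun j => hp _, ?_⟩, fun j => hd _, fun x => ?_⟩
  · rw [← hp1]; exact e.sum_comp p
  · refine (hv x).trans_eq ?_
    exact (e.sum_comp fun j => if good x ((T j).out x) then p j else 0).symm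

open Classical in
theorem Achieves.leaf (lab : L) (hd : 0 ≤ d) (hv : ∀ x, v x ≤ if good x lab then 1 else 0) :
    Achieves good d v :=
  .of_fintype (J := Unit) (fun _ => 1) (fun _ => .leaf lab) (by simp) (by simp)
    (by simpa [DTree.depth] using hd) (fun x => (hv x).trans_eq (by simp only [DTree.out, univ_unique, sum_singleton]; congr!))

theorem Achieves.node (i : κ) {v0 v1 : (κ → Bool) → ℝ} (h0 : Achieves good d v0)
    (h1 : Achieves good d v1) :
    Achieves good (d + 1) (fun x => if x i then v1 x else v0 x) := by
  classical
  obtain ⟨R0, hd0, hv0⟩ := h0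
  obtain ⟨R1, hd1, hv1⟩ := h1
  refine .of_fintype (J := Fin R0.k × Fin R1.k) (fun q => R0.p q.1 * R1.p q.2)
    (fun q => .node i (R0.T q.1) (R1.T q.2))
    (fun q => mul_nonneg (R0.p_nonneg _) (R1.p_nonneg _)) ?_ (fun q => ?_) (fun x => ?_)
  · rw [Fintype.sum_prod_type, ← sum_mul_sum, R0.p_sum, R1.p_sum, mul_one]
  · simp only [DTree.depth, Nat.cast_add, Nat.cast_max, Nat.cast_one]
    linarith [max_le (hd0 q.1) (hd1 q.2)]
  · rw [Fintype.sum_prod_type]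
    cases hx : x i
    · simp only [DTree.out, hx, Bool.false_eq_true, if_false]
      refine (hv0 x).trans_eq (sum_congr rfl fun j _ => ?_)
      split_ifs
      · rw [← mul_sum, R1.p_sum, mul_one]
      · simp
    · simp only [DTree.out, hx, if_true]
      rw [sum_comm]
      refine (hv1 x).trans_eq (sum_congr rfl fun j _ => ?_)
      split_ifs
      · rw [← sum_mul, R0.p_sum, one_mul]
      · simp

theorem Achieves.mix {J : Type} [Fintype J] {p : J → ℝ} (hp : ∀ j, 0 ≤ p j)
    (hp1 : ∑ j, p j = 1) {v : J → (κ → Bool) → ℝ} (h : ∀ j, Achieves good d (v j)) :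
    Achieves good d (fun x => ∑ j, p j * v j x) := by
  classical
  choose R hd hv using h
  refine .of_fintype (J := Σ j, Fin (R j).k) (fun q => p q.1 * (R q.1).p q.2)
    (fun q => (R q.1).T q.2) (fun q => mul_nonneg (hp _) ((R _).p_nonneg _)) ?_
    (fun q => hd _ _) (fun x => ?_)
  · rw [Fintype.sum_sigma]
    simp only [← mul_sum, (R _).p_sum, mul_one, hp1]
  · rw [Fintype.sum_sigma]
    refine sum_le_sum fun j _ => ?_
    refine (mul_le_mul_of_nonneg_left (hv j x) (hp j)).trans_eq ?_
    rw [mul_sum]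
    exact sum_congr rfl fun i _ => by simp

/-- Run a tree within the budget `b`, continuing with the remaining budget at its leaves and
falling back to a query-free algorithm when the budget is exhausted. -/
theorem Achieves.run {ι : Type} (e : ι → κ) {w : (κ → Bool) → ℝ} (hw : Achieves good 0 w)
    {k : Bool → ℝ → (κ → Bool) → ℝ} (hk : ∀ a b, 0 ≤ b → Achieves good b (k a b))
    (t : DTree ι Bool) : ∀ b, 0 ≤ b → Achieves good b fun x =>
      if ((t.cost fun i => x (e i) : ℕ) : ℝ) ≤ b then
        k (t.out fun i => x (e i)) (b - t.cost fun i => x (e i)) x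
      else w x := by
  induction t with
  | leaf lab =>
    intro b hb
    simpa [DTree.cost, DTree.out, hb] using hk lab b hb
  | node i t0 t1 h0 h1 =>
    intro b hb
    by_cases hb1 : 1 ≤ b
    · refine ((h0 (b - 1) (by linarith)).node (e i) (h1 (b - 1) (by linarith))).mono
        (by linarith) fun x => ?_
      cases hx : x (e i) <;>
      · simp only [DTree.cost, DTree.out, hx, Bool.false_eq_true, if_false, if_true, Nat.cast_add,
          Nat.cast_one, le_sub_iff_add_le]
        rw [sub_add_eq_sub_sub_swap]
    · refine hw.mono hb fun x => ?_
      rw [if_neg]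
      simp only [DTree.cost, Nat.cast_add, Nat.cast_one]
      have : (0 : ℝ) ≤ ((if x (e i) = true then t1.cost fun i => x (e i)
        else t0.cost fun i => x (e i) : ℕ) : ℝ) := Nat.cast_nonneg _
      linarith

end Achieves

section Sequential

variable {m : ℕ} {J : Type} [Fintype J]

/-- Success probability of the sequential algorithm with budget `b`, which runs the single-copy
algorithm on the instances of a list in turn and guesses once the budget is exhausted. -/
noncomputable def winProb (p : J → ℝ) (T : J → DTree (Fin m) Bool) (f : (Fin m → Bool) → Bool) :
    List (Fin m → Bool) → ℝ → ℝ
  | [], _ => 1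
  | y :: ys, b => ∑ j, p j * if ((T j).cost y : ℝ) ≤ b then
      (T j).correct f y * winProb p T f ys (b - (T j).cost y) else (1 / 2) ^ (ys.length + 1)

variable {p : J → ℝ} {T : J → DTree (Fin m) Bool} {f : (Fin m → Bool) → Bool}

theorem winProb_nonneg (hp : ∀ j, 0 ≤ p j) (ys : List (Fin m → Bool)) :
    ∀ b, 0 ≤ winProb p T f ys b := by
  induction ys with
  | nil => intro b; simp [winProb]
  | cons y ys ih =>
    intro b
    refine sum_nonneg fun j _ => mul_nonneg (hp j) ?_
    split_ifs
    · exact mul_nonneg ((T j).correct_nonneg f y) (ih _)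
    · positivity

variable {n : ℕ}

open Classical in
theorem achieves_guess (f : (Fin m → Bool) → Bool) (l : List (Fin n)) :
    ∀ acc : Fin n → Bool, Achieves (fun x z => z = fpow f x) 0
      fun x => if ∀ i, i ∉ l → acc i = f (block x i) then (1 / 2) ^ l.length else 0 := by
  induction l with
  | nil =>
    intro acc
    refine .leaf acc le_rfl fun x => ?_
    simp [funext_iff, fpow]
  | cons i l ih =>
    intro acc
    refine (Achieves.mix (J := Bool) (p := fun _ => 1 / 2) (by norm_num) (by norm_num)
      fun a => ih (Function.update acc i a)).mono le_rfl fun x => ?_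
    split_ifs with h
    · have hle : ∀ a : Bool, (0 : ℝ) ≤ 1 / 2 * if ∀ i', i' ∉ l →
          Function.update acc i a i' = f (block x i') then (1 / 2 : ℝ) ^ l.length else 0 :=
        fun a => by positivity
      refine le_trans ?_ (single_le_sum (fun a _ => hle a) (mem_univ (f (block x i))))
      rw [if_pos]
      · simp [pow_succ, mul_comm]
      · intro i' hi'
        by_cases hii : i' = i
        · subst hii; simp
        · rw [Function.update_of_ne hii]
          exact h i' (by simp [hii, hi'])
    · exact sum_nonneg fun a _ => by positivity

open Classical in
theorem achieves_winProb (hp : ∀ j, 0 ≤ p j) (hp1 : ∑ j, p j = 1) (l : List (Fin n)) :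
    ∀ (acc : Fin n → Bool) (b : ℝ), 0 ≤ b → Achieves (fun x z => z = fpow f x) b
      fun x => if ∀ i, i ∉ l → acc i = f (block x i) then winProb p T f (l.map (block x)) b
        else 0 := by
  induction l with
  | nil =>
    intro acc b hb
    refine .leaf acc hb fun x => ?_
    simp [funext_iff, fpow, winProb]
  | cons i l ih =>
    intro acc b hb
    refine (Achieves.mix hp hp1 fun j => Achieves.run (fun q => (i, q))
      (achieves_guess f (i :: l) acc)
      (fun a b hb => ih (Function.update acc i a) b hb) (T j) b hb).mono le_rfl fun x => ?_
    have hblock : (fun q => x (i, q)) = block x i := rfl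
    simp only [hblock]
    split_ifs with h
    · simp only [List.map_cons, winProb, List.length_map, List.length_cons]
      refine sum_le_sum fun j _ => mul_le_mul_of_nonneg_left ?_ (hp j)
      split_ifs with h1 h2
      · exact mul_le_of_le_one_left (winProb_nonneg hp _ _) ((T j).correct_le_one _ _)
      · rw [DTree.correct, if_neg, zero_mul]
        intro h3
        refine h2 fun i' hi' => ?_
        by_cases hii : i' = i
        · subst hii; simpa using h3
        · rw [Function.update_of_ne hii]
          exact h i' (by simp [hii, hi'])
      · exact le_rfl
    · refine sum_nonneg fun j _ => mul_nonneg (hp j) ?_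
      split_ifs
      · exact winProb_nonneg hp _ _
      · positivity
      · exact le_rfl

/-- The sequential algorithm bounds the worst-case complexity of the direct product. -/
theorem RwcN_le_of_winProb {X : Set (Fin m → Bool)} (hp : ∀ j, 0 ≤ p j) (hp1 : ∑ j, p j = 1)
    {B δ : ℝ} (hB : 0 ≤ B)
    (hwin : ∀ ys : List (Fin m → Bool), ys.length = n → (∀ y ∈ ys, y ∈ X) →
      δ ≤ winProb p T f ys B) : (RwcN X f n δ : ℝ) ≤ B := by
  classical
  obtain ⟨R, hd, hR⟩ := achieves_winProb (f := f) (T := T) hp hp1 (List.finRange n)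
    (fun _ => true) B hB
  refine le_trans (Nat.cast_le.2 (Nat.sInf_le (m := ⌊B⌋₊) ⟨R, ?_, ?_, ?_⟩)) (Nat.floor_le hB)
  · intro j _
    generalize R.T j = t
    induction t with
    | leaf => trivial
    | node i t0 t1 h0 h1 => exact ⟨h0, h1⟩
  · intro x hx
    refine le_trans (hwin ((List.finRange n).map (block x)) (by simp) ?_) ?_
    · simp only [List.mem_map]
      rintro y ⟨i, -, rfl⟩
      exact hx i
    · have := hR x
      beta_reduce at this
      rw [if_pos (by simp)] at this
      convert this
  · exact fun j _ => Nat.le_floor (hd j)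

/-- Lower bound for the success probability via the exponentially discounted success. -/
theorem le_winProb_of_discounted (hp : ∀ j, 0 ≤ p j) {X : Set (Fin m → Bool)} {α G : ℝ}
    (hα : 0 ≤ α) (hG : 1 ≤ G)
    (h : ∀ y ∈ X, G ≤ ∑ j, p j * (2 * (T j).correct f y *
      Real.exp (-(α * (T j).cost y)))) (ys : List (Fin m → Bool)) :
    ∀ b, 0 ≤ b → (∀ y ∈ ys, y ∈ X) →
      (1 / 2) ^ (ys.length + 1) * min (G ^ ys.length) (Real.exp (α * b)) ≤
        winProb p T f ys b := by
  induction ys with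
  | nil =>
    intro b hb _
    have : min ((1 : ℝ)) (Real.exp (α * b)) ≤ 1 := min_le_left _ _
    simp only [List.length_nil, pow_zero, winProb]
    linarith
  | cons y ys ih =>
    intro b hb hX
    have hy := h y (hX y (by simp))
    set M := min (G ^ ys.length) (Real.exp (α * b)) with hM
    have hM0 : 0 ≤ M := by positivity
    have hGM : min (G ^ (ys.length + 1)) (Real.exp (α * b)) ≤ G * M := by
      rw [hM, mul_min_of_nonneg _ _ (by linarith), ← pow_succ']
      exact min_le_min le_rfl (le_mul_of_one_le_left (Real.exp_pos _).le hG)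
    simp only [List.length_cons, winProb]
    calc (1 / 2) ^ (ys.length + 1 + 1) * min (G ^ (ys.length + 1)) (Real.exp (α * b))
        ≤ (1 / 2) ^ (ys.length + 1 + 1) * (G * M) := by gcongr
      _ ≤ (1 / 2) ^ (ys.length + 1 + 1) * ((∑ j, p j * (2 * (T j).correct f y *
            Real.exp (-(α * (T j).cost y)))) * M) := by gcongr
      _ ≤ _ := by
        rw [sum_mul, mul_sum]
        refine sum_le_sum fun j _ => ?_
        have hc0 := (T j).correct_nonneg f y
        have hc1 := (T j).correct_le_one f y
        set E := Real.exp (-(α * (T j).cost y)) with hE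
        have hEb : E * Real.exp (α * b) = Real.exp (α * (b - (T j).cost y)) := by
          rw [hE, ← Real.exp_add]; congr 1; ring
        have hE1 : E ≤ 1 := Real.exp_le_one_iff.2 (neg_nonpos.2 (by positivity))
        have hE0 : 0 ≤ E := (Real.exp_pos _).le
        rw [show (1 / 2 : ℝ) ^ (ys.length + 1 + 1) * (p j * (2 * (T j).correct f y * E) * M) =
          p j * ((1 / 2) ^ (ys.length + 1) * ((T j).correct f y * (E * M))) by ring]
        refine mul_le_mul_of_nonneg_left ?_ (hp j)
        have hEM : E * M ≤ Real.exp (α * (b - (T j).cost y)) := by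
          rw [← hEb]; exact mul_le_mul_of_nonneg_left (min_le_right _ _) hE0
        split_ifs with hcost
        · have := ih (b - (T j).cost y) (by linarith) fun z hz => hX z (by simp [hz])
          calc (1 / 2 : ℝ) ^ (ys.length + 1) * ((T j).correct f y * (E * M))
              = (T j).correct f y * ((1 / 2) ^ (ys.length + 1) * (E * M)) := by ring
            _ ≤ (T j).correct f y * ((1 / 2) ^ (ys.length + 1) *
                min (G ^ ys.length) (Real.exp (α * (b - (T j).cost y)))) := by
              gcongr
              refine le_min ?_ hEM
              exact (mul_le_of_le_one_left hM0 hE1).trans (min_le_left _ _)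
            _ ≤ _ := by gcongr
        · refine mul_le_of_le_one_right (by positivity) ?_
          have : Real.exp (α * (b - (T j).cost y)) ≤ 1 := by
            refine Real.exp_le_one_iff.2 (mul_nonpos_of_nonneg_of_nonpos hα ?_)
            linarith
          exact mul_le_one₀ hc1 (by positivity) (hEM.trans this)

/-- Lower bound for the success probability via Markov's inequality. -/
theorem le_winProb_of_markov (hp : ∀ j, 0 ≤ p j) {X : Set (Fin m → Bool)}
    {s K B : ℝ} (hs : 0 < s) (hK : 0 ≤ K) (hB : 0 < B)
    (hsucc : ∀ y ∈ X, s ≤ ∑ j, p j * (T j).correct f y)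
    (hcost : ∀ y ∈ X, ∑ j, p j * ((T j).cost y : ℝ) ≤ s * K) (ys : List (Fin m → Bool)) :
    ∀ b ≤ B, (∀ y ∈ ys, y ∈ X) →
      s ^ ys.length * ((b - ys.length * K) / B) ≤ winProb p T f ys b := by
  induction ys with
  | nil =>
    intro b hb _
    simp only [List.length_nil, winProb, pow_zero, Nat.cast_zero, zero_mul, sub_zero, one_mul]
    exact (div_le_one hB).2 hb
  | cons y ys ih =>
    intro b hb hX
    have hy1 := hsucc y (hX y (by simp))
    have hy2 := hcost y (hX y (by simp))
    by_cases hneg : b - ys.length * K < 0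
    · refine le_trans ?_ (winProb_nonneg hp _ _)
      refine mul_nonpos_of_nonneg_of_nonpos (by positivity) (div_nonpos_of_nonpos_of_nonneg ?_ hB.le)
      simp only [List.length_cons, Nat.cast_add, Nat.cast_one]
      nlinarith
    push Not at hneg
    have hs' : 0 ≤ s ^ ys.length / B := by positivity
    calc s ^ (y :: ys).length * ((b - (y :: ys).length * K) / B)
        = s ^ ys.length / B * (s * (b - ys.length * K) - s * K) := by
          simp only [List.length_cons, Nat.cast_add, Nat.cast_one, pow_succ]; ring
      _ ≤ s ^ ys.length / B * ((∑ j, p j * (T j).correct f y) * (b - ys.length * K) -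
            ∑ j, p j * ((T j).cost y : ℝ)) := by gcongr
      _ = ∑ j, p j * (s ^ ys.length / B *
            ((T j).correct f y * (b - ys.length * K) - (T j).cost y)) := by
          rw [sum_mul, ← sum_sub_distrib, mul_sum]
          exact sum_congr rfl fun j _ => by ring
      _ ≤ winProb p T f (y :: ys) b := by
        simp only [winProb]
        refine sum_le_sum fun j _ => mul_le_mul_of_nonneg_left ?_ (hp j)
        have hc0 := (T j).correct_nonneg f y
        have hc1 := (T j).correct_le_one f y
        have hcost0 : (0 : ℝ) ≤ (T j).cost y := Nat.cast_nonneg _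
        split_ifs with hle
        · refine le_trans ?_ (mul_le_mul_of_nonneg_left
            (ih (b - (T j).cost y) (by linarith) fun z hz => hX z (by simp [hz])) hc0)
          rw [show (T j).correct f y * (s ^ ys.length * ((b - (T j).cost y - ys.length * K) / B)) =
            s ^ ys.length / B * ((T j).correct f y * (b - ys.length * K) -
              (T j).correct f y * (T j).cost y) by ring]
          gcongr
          exact mul_le_of_le_one_left hcost0 hc1
        · refine le_trans (mul_nonpos_of_nonneg_of_nonpos hs' ?_) (by positivity)
          have : (ys.length : ℝ) * K ≥ 0 := by positivity
          nlinarith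

end Sequential

section DirectProduct

variable {m : ℕ} {X : Set (Fin m → Bool)} {f : (Fin m → Bool) → Bool} {γ : ℝ} {n : ℕ}

/-- If the single-copy complexity vanishes then the function is constant on its domain. -/
theorem exists_const_of_succRmax_eq_zero (h1 : 1 / 2 < γ) (h2 : γ ≤ 1)
    (hc : succRmax X f γ = 0) : ∃ b, ∀ y ∈ X, f y = b := by
  by_contra! hne
  obtain ⟨y₀, hy₀, hf₀⟩ := hne true
  obtain ⟨y₁, hy₁, hf₁⟩ := hne false
  set θ := (γ + 1 / 2) / 2
  have hθ : 1 / 2 < θ := by simp only [θ]; linarith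
  obtain ⟨J, _, p, T, hp, hp1, h⟩ := exists_minimax_alg (X := X) (f := f) (γ := γ)
    (κ := 1) (θ := θ) h2 zero_le_one (by rw [hc]; simp only [θ]; linarith)
  have h₀ := h y₀ hy₀
  have h₁ := h y₁ hy₁
  have hle : ∑ j, p j * (T j).correct f y₀ + ∑ j, p j * (T j).correct f y₁ ≤
      1 + ∑ j, p j * ((T j).cost y₀ : ℝ) := by
    rw [← hp1, ← sum_add_distrib, ← sum_add_distrib]
    refine sum_le_sum fun j _ => ?_
    rw [← mul_add]
    refine (mul_le_mul_of_nonneg_left (?_ : _ ≤ 1 + ((T j).cost y₀ : ℝ)) (hp j)).trans_eq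
      (by ring)
    cases T j with
    | leaf b =>
      simp only [DTree.correct, DTree.out, DTree.cost]
      cases b <;> simp_all
    | node i t0 t1 =>
      have ha := (DTree.node i t0 t1).correct_le_one f y₀
      have hb := (DTree.node i t0 t1).correct_le_one f y₁
      have : (1 : ℝ) ≤ ((DTree.node i t0 t1).cost y₀ : ℝ) := by
        simp only [DTree.cost, Nat.cast_add, Nat.cast_one, le_add_iff_nonneg_left]
        positivity
      linarith
  have hcost : 0 ≤ ∑ j, p j * ((T j).cost y₁ : ℝ) :=
    sum_nonneg fun j _ => mul_nonneg (hp j) (Nat.cast_nonneg _)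
  linarith

theorem RwcN_eq_zero_of_const {b : Bool} (hb : ∀ y ∈ X, f y = b) {δ : ℝ} (hδ : δ ≤ 1) :
    (RwcN X f n δ : ℝ) ≤ 0 := by
  refine RwcN_le_of_winProb (J := Unit) (p := fun _ => 1) (T := fun _ => .leaf b) (by simp)
    (by simp) le_rfl fun ys _ hys => hδ.trans_eq ?_
  clear * - hb hys
  induction ys with
  | nil => rfl
  | cons y ys ih =>
    have h := ih fun z hz => hys z (by simp [hz])
    have hy : f y = b := hb y (hys y (by simp))
    rw [winProb]
    simp only [univ_unique, sum_singleton, DTree.cost, Nat.cast_zero, le_refl, if_true, sub_zero,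
      DTree.correct, DTree.out, hy, one_mul]
    exact h

theorem two_mul_pow_le {a b δ : ℝ} (ha : 0 < a) (hb : a * (1 + δ) ≤ b) (hδ : 0 ≤ δ)
    (hn : 1 ≤ n * δ) : 2 * a ^ n ≤ b ^ n := by
  have h1 : 1 + n * δ ≤ (1 + δ) ^ n := one_add_mul_le_pow (by linarith) n
  calc 2 * a ^ n ≤ (1 + δ) ^ n * a ^ n := by gcongr; linarith
    _ = (a * (1 + δ)) ^ n := by rw [mul_pow, mul_comm]
    _ ≤ b ^ n := by gcongr

/-- The direct product upper bound when the success probability is close to `1 / 2`. -/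
theorem RwcN_le_of_small_advantage (h1 : 1 / 2 < γ) (h2 : γ ≤ 3 / 4) (hn : 10 ≤ n * (γ - 1 / 2))
    (hc : 0 < succRmax X f γ) : (RwcN X f n (γ ^ n) : ℝ) ≤ 220 * n * succRmax X f γ := by
  set c := succRmax X f γ with hcdef
  set η := γ - 1 / 2 with hη
  have hη0 : 0 < η := by linarith
  have hη1 : η ≤ 1 / 4 := by linarith
  set κ := η / (10 * c) with hκ
  have hκc : κ * c = η / 10 := by rw [hκ]; field_simp
  have hκ0 : 0 < κ := by positivity
  obtain ⟨J, _, p, T, hp, hp1, h⟩ := exists_minimax_alg (X := X) (f := f) (γ := γ)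
    (κ := κ) (θ := γ - η / 5) (by linarith) hκ0.le (by rw [← hcdef, hκc]; linarith)
  obtain ⟨J', _, p', T', hp', hp1', h'⟩ := exists_majority_alg p T f hp hp1
  refine RwcN_le_of_winProb hp' hp1' (T := T') (by positivity) fun ys hlen hys => ?_
  have hdisc := le_winProb_of_discounted (T := T') (f := f) hp' (X := X) (α := κ / 10)
    (G := 1 + 11 / 5 * η) (by positivity) (by linarith) ?_ ys (220 * n * c) (by positivity) hys
  · refine le_trans ?_ hdisc
    rw [hlen, min_eq_left]
    · have := two_mul_pow_le (n := n) (a := 1 + 2 * η) (b := 1 + 11 / 5 * η) (δ := η / 10)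
        (by linarith) (by nlinarith) (by linarith) (by linarith)
      have hγ : γ ^ n = (1 / 2) ^ n * (1 + 2 * η) ^ n := by
        rw [← mul_pow]; congr 1; rw [hη]; ring
      rw [hγ, pow_succ, mul_assoc]
      gcongr
      linarith
    · calc (1 + 11 / 5 * η) ^ n ≤ Real.exp (11 / 5 * η) ^ n := by
            gcongr
            rw [add_comm]; exact Real.add_one_le_exp _
        _ = Real.exp (κ / 10 * (220 * n * c)) := by
            rw [← Real.exp_nat_mul]
            congr 1
            rw [show κ / 10 * (220 * n * c) = 22 * n * (κ * c) by ring, hκc]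
            ring
  · intro y hy
    obtain ⟨hcost, hsucc⟩ := h' y
    have hy' := h y hy
    set s := ∑ j, p j * (T j).correct f y
    set q := κ * ∑ j, p j * ((T j).cost y : ℝ) with hq
    have hq0 : 0 ≤ q := mul_nonneg hκ0.le
      (sum_nonneg fun j _ => mul_nonneg (hp j) (Nat.cast_nonneg _))
    have hs1 : s ≤ 1 := by
      rw [← hp1]
      exact sum_le_sum fun j _ => mul_le_of_le_one_right (hp j) ((T j).correct_le_one f y)
    have hexp : ∑ j, p' j * (2 * (T' j).correct f y - 2 * (κ / 10) * (T' j).cost y) ≤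
        ∑ j, p' j * (2 * (T' j).correct f y * Real.exp (-(κ / 10 * (T' j).cost y))) := by
      refine sum_le_sum fun j _ => mul_le_mul_of_nonneg_left ?_ (hp' j)
      have hc0 := (T' j).correct_nonneg f y
      have hc1 := (T' j).correct_le_one f y
      have he := Real.add_one_le_exp (-(κ / 10 * (T' j).cost y))
      have hk : 0 ≤ κ / 10 * (T' j).cost y := by positivity
      nlinarith
    refine le_trans ?_ hexp
    have hval : ∑ j, p' j * (2 * (T' j).correct f y - 2 * (κ / 10) * (T' j).cost y) =
        2 * (3 * s ^ 2 - 2 * s ^ 3) - 3 / 5 * q := by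
      simp only [mul_sub, sum_sub_distrib, mul_left_comm _ (2 : ℝ), ← mul_sum,
        mul_left_comm _ (2 * (κ / 10))]
      rw [hsucc, hcost, hq]
      ring
    rw [hval]
    obtain ⟨a, hsa⟩ : ∃ a, s = 1 / 2 + a := ⟨s - 1 / 2, by ring⟩
    have ha : 4 / 5 * η + q ≤ a := by linarith
    have ha1 : a ≤ 1 / 2 := by linarith
    have hcubic : 43 / 25 * η ≤ 12 / 5 * a - 4 * a ^ 3 := by
      have ha0 : 0 < a := by linarith
      rcases le_total a (1 / 4) with h4 | h4
      · have : a * a ^ 2 ≤ a * (1 / 4) ^ 2 := by gcongr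
        linarith
      · have : 0 ≤ (a - 1 / 4) * (1 / 2 - a) * (a + 3 / 4) :=
          mul_nonneg (mul_nonneg (by linarith) (by linarith)) (by linarith)
        linarith
    rw [hsa, show 2 * (3 * (1 / 2 + a) ^ 2 - 2 * (1 / 2 + a) ^ 3) = 1 + 3 * a - 4 * a ^ 3 by ring]
    linarith

/-- The direct product upper bound when the success probability is bounded away from `1 / 2`. -/
theorem RwcN_le_of_small_error (h1 : 3 / 4 ≤ γ) (h2 : γ < 1) (hn : 20 ≤ n * (1 - γ))
    (hc : 0 < succRmax X f γ) : (RwcN X f n (γ ^ n) : ℝ) ≤ 220 * n * succRmax X f γ := by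
  set c := succRmax X f γ with hcdef
  set ε := 1 - γ with hε
  have hε0 : 0 < ε := by linarith
  have hε1 : ε ≤ 1 / 4 := by linarith
  have hn0 : (0 : ℝ) < n := by
    by_contra! hn0
    nlinarith
  set κ := ε / (10 * c) with hκ
  have hκc : κ * c = ε / 10 := by rw [hκ]; field_simp
  have hκ0 : 0 < κ := by positivity
  obtain ⟨J, _, p, T, hp, hp1, h⟩ := exists_minimax_alg (X := X) (f := f) (γ := γ)
    (κ := κ) (θ := γ - ε / 5) (by linarith) hκ0.le (by rw [← hcdef, hκc]; linarith)
  obtain ⟨J', _, p', T', hp', hp1', h'⟩ := exists_majority_alg p T f hp hp1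
  refine RwcN_le_of_winProb hp' hp1' (T := T') (by positivity) fun ys hlen hys => ?_
  set s₀ := 1 - 9 / 10 * ε with hs₀
  have hs₀' : 3 / 4 ≤ s₀ := by linarith
  have hbound : ∀ y ∈ X, s₀ ≤ ∑ j, p' j * (T' j).correct f y ∧
      ∑ j, p' j * ((T' j).cost y : ℝ) ≤ 36 * c := by
    intro y hy
    obtain ⟨hcost, hsucc⟩ := h' y
    have hy' := h y hy
    set s := ∑ j, p j * (T j).correct f y
    set q := ∑ j, p j * ((T j).cost y : ℝ) with hq
    have hq0 : 0 ≤ q := sum_nonneg fun j _ => mul_nonneg (hp j) (Nat.cast_nonneg _)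
    have hs1 : s ≤ 1 := by
      rw [← hp1]
      exact sum_le_sum fun j _ => mul_le_of_le_one_right (hp j) ((T j).correct_le_one f y)
    constructor
    · rw [hsucc, hs₀]
      obtain ⟨e, he⟩ : ∃ e, s = 1 - e := ⟨1 - s, by ring⟩
      have hκq : 0 ≤ κ * q := by positivity
      have he1 : e ≤ 6 / 5 * ε := by linarith
      have he0 : 0 ≤ e := by linarith
      rw [he]
      have : e * (e * (3 - 2 * e)) ≤ 6 / 5 * ε * (3 / 4) := by
        apply mul_le_mul he1 _ (mul_nonneg he0 (by linarith)) (by linarith)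
        nlinarith
      nlinarith
    · rw [hcost]
      have : κ * q ≤ κ * (12 * c) := by
        rw [mul_left_comm, hκc]
        linarith
      linarith [le_of_mul_le_mul_left this hκ0]
  have hmarkov := le_winProb_of_markov (T := T') (f := f) hp' (X := X) (s := s₀)
    (K := 48 * c) (B := 220 * n * c) (by linarith) (by positivity) (by positivity)
    (fun y hy => (hbound y hy).1)
    (fun y hy => (hbound y hy).2.trans (by nlinarith)) ys _ le_rfl hys
  refine le_trans ?_ hmarkov
  rw [hlen, show (220 * n * c - n * (48 * c)) / (220 * n * c) = (172 / 220 : ℝ) by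
    field_simp; norm_num]
  have := two_mul_pow_le (n := n) (a := γ) (b := s₀) (δ := ε / 10)
    (by linarith) (by nlinarith) (by linarith) (by linarith)
  have hpos : 0 ≤ γ ^ n := by positivity
  linarith

end DirectProduct

/-- **Optimal direct product theorem, upper bound**: there are universal constants `C, c`
such that for all `γ ∈ (1/2,1)` and all integers `n ≥ c/(min{2γ−1, 1−γ})²`,
`R_{γⁿ}(fⁿ) ≤ C·n·R̄̄_γ(f)`. -/
theorem optimal_direct_product_upper_bound :
    ∃ C c : ℝ, 0 < C ∧ 0 < c ∧
      ∀ (m : ℕ) (X : Set (Fin m → Bool)) (f : (Fin m → Bool) → Bool) (γ : ℝ),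
        1 / 2 < γ → γ < 1 → ∀ n : ℕ,
        c / (min (2 * γ - 1) (1 - γ)) ^ 2 ≤ (n : ℝ) →
        (RwcN X f n (γ ^ n) : ℝ) ≤ C * n * succRmax X f γ := by
  refine ⟨220, 20, by norm_num, by norm_num, fun m X f γ h1 h2 n hn => ?_⟩
  rcases (succRmax_nonneg X f γ).eq_or_lt with hc | hc
  · obtain ⟨b, hb⟩ := exists_const_of_succRmax_eq_zero h1 h2.le hc.symm
    rw [← hc, mul_zero]
    exact RwcN_eq_zero_of_const hb (pow_le_one₀ (by linarith) h2.le)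
  set w := min (2 * γ - 1) (1 - γ) with hw
  have hw0 : 0 < w := lt_min (by linarith) (by linarith)
  have hwl : w ≤ 2 * γ - 1 := min_le_left _ _
  have hwr : w ≤ 1 - γ := min_le_right _ _
  rw [div_le_iff₀ (by positivity)] at hn
  have hn0 : (0 : ℝ) ≤ n := Nat.cast_nonneg n
  have hnw : 20 ≤ n * w := by
    have : (n : ℝ) * w * w ≤ n * w * 1 := by gcongr; linarith
    linarith
  rcases le_total γ (3 / 4) with h | h
  · exact RwcN_le_of_small_advantage h1 h (by nlinarith) hc
  · exact RwcN_le_of_small_error h h2 (by nlinarith) hc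
end
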